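/- arXiv:1105.5490 — 2 statements merged into one kernel-verified Lean document; each statement's English description precedes it below -/
import Mathlib

section
/- There exists a positive integer N such that for every integer k ≥ N there exist infinitely many pairwise non-isomorphic connected k-regular finite simple graphs G whose smallest adjacency eigenvalue λmin(G) lies in the half-open interval [α₁, −1−√2), where α₁ is the smallest real root of the polynomial x³ + 2x² − 2x − 2. -/
open SimpleGraph Filter

attribute [local instance] Classical.propDecidable

lemma adjMatrix_isHermitian {V : Type} [Fintype V] [DecidableEq V] (G : SimpleGraph V)
    [DecidableRel G.Adj] : (G.adjMatrix ℝ).IsHermitian := by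
  rw [Matrix.IsHermitian, Matrix.conjTranspose_eq_transpose_of_trivial]
  exact G.isSymm_adjMatrix

/-- The smallest eigenvalue of the (real) adjacency matrix of a finite simple graph. -/
noncomputable def lambdaMin {V : Type} [Fintype V] (G : SimpleGraph V) : ℝ :=
  ⨅ i : V, (adjMatrix_isHermitian G).eigenvalues i

lemma lambdaMin_eq_sInf_spectrum {V : Type} [Fintype V] (G : SimpleGraph V) :
    lambdaMin G = sInf (spectrum ℝ (G.adjMatrix ℝ)) := by
  rw [(adjMatrix_isHermitian G).spectrum_real_eq_range_eigenvalues]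
  rfl

lemma SimpleGraph.Iso.lambdaMin_eq {V W : Type} [Fintype V] [Fintype W] {G : SimpleGraph V}
    {H : SimpleGraph W} (e : G ≃g H) : lambdaMin G = lambdaMin H := by
  rw [lambdaMin_eq_sInf_spectrum, lambdaMin_eq_sInf_spectrum, ← e.reindex_adjMatrix ℝ,
    ← Matrix.coe_reindexAlgEquiv ℝ ℝ, AlgEquiv.spectrum_eq]

open Matrix in
lemma lambdaMin_eq_of_form_le {V : Type} [Fintype V] (G : SimpleGraph V) {μ : ℝ}
    (hle : ∀ y : V → ℝ, μ * (y ⬝ᵥ y) ≤ y ⬝ᵥ (G.adjMatrix ℝ *ᵥ y))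
    {z : V → ℝ} (hz : z ≠ 0) (hμ : G.adjMatrix ℝ *ᵥ z = μ • z) : lambdaMin G = μ := by
  rw [lambdaMin_eq_sInf_spectrum, ← Matrix.spectrum_toLin']
  refine IsLeast.csInf_eq ⟨?_, fun ν hν => ?_⟩
  · exact (Module.End.hasEigenvalue_of_hasEigenvector
      (x := z) ⟨Module.End.mem_eigenspace_iff.2 (by simpa using hμ), hz⟩).mem_spectrum
  · obtain ⟨y, hy, hy0⟩ := (Module.End.hasEigenvalue_iff_mem_spectrum.2 hν).exists_hasEigenvector
    have h := hle y
    have hy' : G.adjMatrix ℝ *ᵥ y = ν • y := by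
      simpa using Module.End.mem_eigenspace_iff.1 hy
    rw [hy', dotProduct_smul, smul_eq_mul] at h
    have hpos : 0 < y ⬝ᵥ y :=
      lt_of_le_of_ne (Finset.sum_nonneg fun i _ => mul_self_nonneg _)
        fun h0 => hy0 (dotProduct_self_eq_zero.1 h0.symm)
    exact le_of_mul_le_mul_right h hpos

/-- Copies of `P` indexed by `X`; for each vertex `i` of `P`, the copies of `i` whose indices share
the same value of `c i` form a clique. -/
def cliqueExtension {I X κ : Type} (P : SimpleGraph I) (c : I → X → κ) : SimpleGraph (X × I) where
  Adj p q := (p.1 = q.1 ∧ P.Adj p.2 q.2) ∨ (p.2 = q.2 ∧ p.1 ≠ q.1 ∧ c p.2 q.1 = c p.2 p.1)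
  symm := ⟨by
    rintro ⟨x, i⟩ ⟨y, j⟩ (⟨h, h'⟩ | ⟨h, h', h''⟩)
    · exact Or.inl ⟨h.symm, h'.symm⟩
    · exact Or.inr ⟨h.symm, h'.symm, by dsimp only at *; subst h; exact h''.symm⟩⟩
  loopless := ⟨by rintro ⟨x, i⟩ (⟨_, h⟩ | ⟨_, h, _⟩); exacts [P.loopless.irrefl _ h, h rfl]⟩

lemma cliqueExtension_adj {I X κ : Type} {P : SimpleGraph I} {c : I → X → κ} {p q : X × I} :
    (cliqueExtension P c).Adj p q ↔
      (p.1 = q.1 ∧ P.Adj p.2 q.2) ∨ (p.2 = q.2 ∧ p.1 ≠ q.1 ∧ c p.2 q.1 = c p.2 p.1) :=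
  Iff.rfl

/-- The sum of `y` over the fiber of `f` through `x`. -/
noncomputable def fiberSum {X κ : Type} [Fintype X] (f : X → κ) (y : X → ℝ) (x : X) : ℝ :=
  ∑ x', if f x' = f x then y x' else 0

lemma fiberSum_eq_sum_of_range {J X κ : Type} [Fintype J] [Fintype X] {f : X → κ} (y : X → ℝ)
    {x : X} {e : J → X} (he : e.Injective) (hr : ∀ x', f x' = f x ↔ x' ∈ Set.range e) :
    fiberSum f y x = ∑ j, y (e j) := by
  refine (Finset.sum_of_injOn e he.injOn (by simp) (fun x' _ hx' => ?_) fun j _ => ?_).symm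
  · rw [if_neg]
    rw [hr]
    simpa using hx'
  · rw [if_pos ((hr _).2 ⟨j, rfl⟩)]

section cliqueExtension

variable {I X κ : Type} [Fintype I] [Fintype X] (P : SimpleGraph I) (c : I → X → κ)

open Matrix

lemma cliqueExtension_mulVec (y : X × I → ℝ) (x : X) (i : I) :
    ((cliqueExtension P c).adjMatrix ℝ *ᵥ y) (x, i) =
      (P.adjMatrix ℝ *ᵥ fun j => y (x, j)) i +
        fiberSum (c i) (fun x' => y (x', i)) x - y (x, i) := by
  have key : ∀ x' j, (cliqueExtension P c).adjMatrix ℝ (x, i) (x', j) * y (x', j) =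
      (if x = x' then P.adjMatrix ℝ i j * y (x, j) else 0) +
      (if i = j then ((if c i x' = c i x then y (x', i) else 0) -
        (if x = x' then y (x, i) else 0)) else 0) := by
    intro x' j
    by_cases hx : x = x'
    · subst hx
      by_cases hi : i = j
      · subst hi
        simp [adjMatrix_apply]
      · simp [cliqueExtension_adj, adjMatrix_apply, hi]
    · by_cases hi : i = j
      · subst hi
        simp [cliqueExtension_adj, adjMatrix_apply, hx]
      · simp [cliqueExtension_adj, adjMatrix_apply, hi, hx]
  simp only [mulVec, dotProduct, Fintype.sum_prod_type]
  simp_rw [key, Finset.sum_add_distrib, Finset.sum_ite_eq, Finset.mem_univ, if_true,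
    Finset.sum_sub_distrib]
  rw [Finset.sum_comm]
  simp [fiberSum, add_sub_assoc]

lemma sum_mul_fiberSum_nonneg [Fintype κ] (f : X → κ) (y : X → ℝ) :
    0 ≤ ∑ x, y x * fiberSum f y x := by
  have : ∑ x, y x * fiberSum f y x =
      ∑ t, (∑ x, if f x = t then y x else 0) * ∑ x, if f x = t then y x else 0 := by
    simp_rw [fiberSum, Finset.sum_mul_sum, Finset.mul_sum]
    conv_rhs => rw [Finset.sum_comm]
    refine Finset.sum_congr rfl fun x _ => ?_
    conv_rhs => rw [Finset.sum_comm]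
    refine Finset.sum_congr rfl fun x' _ => ?_
    simp [eq_comm]
  rw [this]
  exact Finset.sum_nonneg fun t _ => mul_self_nonneg _

lemma cliqueExtension_form_le [Fintype κ] {τ : ℝ}
    (hP : ∀ u : I → ℝ, τ * (u ⬝ᵥ u) ≤ u ⬝ᵥ (P.adjMatrix ℝ *ᵥ u)) (y : X × I → ℝ) :
    (τ - 1) * (y ⬝ᵥ y) ≤ y ⬝ᵥ ((cliqueExtension P c).adjMatrix ℝ *ᵥ y) := by
  have h1 : y ⬝ᵥ y = ∑ x, (fun j => y (x, j)) ⬝ᵥ (fun j => y (x, j)) := by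
    simp only [dotProduct, Fintype.sum_prod_type]
  have h2 : y ⬝ᵥ ((cliqueExtension P c).adjMatrix ℝ *ᵥ y) =
      (∑ x, (fun j => y (x, j)) ⬝ᵥ (P.adjMatrix ℝ *ᵥ fun j => y (x, j))) +
      (∑ i, ∑ x, y (x, i) * fiberSum (c i) (fun x' => y (x', i)) x) - y ⬝ᵥ y := by
    rw [Finset.sum_comm]
    simp only [dotProduct, Fintype.sum_prod_type, cliqueExtension_mulVec, mul_sub, mul_add,
      Finset.sum_add_distrib, Finset.sum_sub_distrib]
  have h3 : 0 ≤ ∑ i, ∑ x, y (x, i) * fiberSum (c i) (fun x' => y (x', i)) x :=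
    Finset.sum_nonneg fun i _ => sum_mul_fiberSum_nonneg (c i) fun x => y (x, i)
  have h4 : τ * (y ⬝ᵥ y) ≤ ∑ x, (fun j => y (x, j)) ⬝ᵥ (P.adjMatrix ℝ *ᵥ fun j => y (x, j)) := by
    rw [h1, Finset.mul_sum]
    exact Finset.sum_le_sum fun x _ => hP _
  rw [h2]
  linarith

lemma cliqueExtension_mulVec_tensor {τ : ℝ} {u : I → ℝ} (hu : P.adjMatrix ℝ *ᵥ u = τ • u)
    {f : X → ℝ} (hf : ∀ i x, fiberSum (c i) f x = 0) :
    (cliqueExtension P c).adjMatrix ℝ *ᵥ (fun p => f p.1 * u p.2) =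
      (τ - 1) • fun p => f p.1 * u p.2 := by
  ext ⟨x, i⟩
  rw [cliqueExtension_mulVec]
  have h1 : (fun j => f x * u j) = f x • u := rfl
  have h2 : fiberSum (c i) (fun x' => f x' * u i) x = 0 := by
    have := hf i x
    simp only [fiberSum, ← ite_zero_mul, ← Finset.sum_mul] at this ⊢
    rw [this, zero_mul]
  dsimp only
  rw [h1, h2, mulVec_smul, hu]
  simp only [Pi.smul_apply, smul_eq_mul]
  ring

lemma cliqueExtension_degree (x : X) (i : I) :
    ((cliqueExtension P c).degree (x, i) : ℝ) =
      P.degree i + fiberSum (c i) (fun _ => 1) x - 1 := by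
  have h := cliqueExtension_mulVec P c (Function.const _ 1) x i
  rw [adjMatrix_mulVec_const_apply] at h
  have h' := adjMatrix_mulVec_const_apply (α := ℝ) (G := P) (a := 1) (v := i)
  simp only [mul_one] at h h'
  rw [h, ← h']
  rfl

end cliqueExtension

lemma cliqueExtension_reachable_of_eq {I X κ : Type} {P : SimpleGraph I} (hP : P.Connected)
    (c : I → X → κ) {i j k : I} {x x' : X} (h : c i x' = c i x) :
    (cliqueExtension P c).Reachable (x, j) (x', k) := by
  have key : ∀ z j k, (cliqueExtension P c).Reachable (z, j) (z, k) := fun z j k =>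
    (hP.preconnected j k).map (⟨fun i => (z, i), fun h => Or.inl ⟨rfl, h⟩⟩ :
      P →g cliqueExtension P c)
  refine (key x j i).trans (Reachable.trans ?_ (key x' i k))
  by_cases hx : x = x'
  · rw [hx]
  · exact (show (cliqueExtension P c).Adj (x, i) (x', i) from Or.inr ⟨rfl, hx, h⟩).reachable

/-- The triangle `0, 1, 2` with a pendant vertex `3` attached to `0`. -/
def paw : SimpleGraph (Fin 4) where
  Adj i j := i ≠ j ∧ (i = 0 ∨ j = 0 ∨ (i ≠ 3 ∧ j ≠ 3))
  symm := ⟨by tauto⟩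
  loopless := ⟨by tauto⟩

lemma paw_adj {i j : Fin 4} : paw.Adj i j ↔ i ≠ j ∧ (i = 0 ∨ j = 0 ∨ (i ≠ 3 ∧ j ≠ 3)) :=
  Iff.rfl

lemma paw_adjMatrix :
    paw.adjMatrix ℝ = !![0, 1, 1, 1; 1, 0, 1, 0; 1, 1, 0, 0; 1, 0, 0, 0] := by
  ext i j
  fin_cases i <;> fin_cases j <;> simp [paw_adj, adjMatrix_apply]

lemma paw_connected : paw.Connected := by
  rw [connected_iff_exists_forall_reachable]
  refine ⟨0, fun j => ?_⟩
  by_cases h : 0 = j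
  · rw [h]
  · exact Adj.reachable (show paw.Adj 0 j from ⟨h, Or.inl rfl⟩)

open Matrix in
lemma paw_degree (i : Fin 4) : (paw.degree i : ℝ) = ![3, 2, 2, 1] i := by
  have h := adjMatrix_mulVec_const_apply (α := ℝ) (G := paw) (a := 1) (v := i)
  rw [mul_one] at h
  rw [← h, paw_adjMatrix]
  fin_cases i <;> simp [mulVec, dotProduct, Fin.sum_univ_four] <;> norm_num

open Matrix in
lemma paw_form_le {t : ℝ} (ht : 1 < t) (h : t ^ 3 + t ^ 2 - 3 * t - 1 = 0) (u : Fin 4 → ℝ) :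
    -t * (u ⬝ᵥ u) ≤ u ⬝ᵥ (paw.adjMatrix ℝ *ᵥ u) := by
  rw [paw_adjMatrix]
  simp only [mulVec, dotProduct, Fin.sum_univ_four]
  simp
  generalize u 0 = a
  generalize u 1 = b
  generalize u 2 = c
  generalize u 3 = d
  have h0 : 0 < t * (t + 1) := by positivity
  have h1 : t - 1 / t - 2 / (t + 1) = 0 := by
    field_simp
    linarith
  have h2 : 0 ≤ t * (d + a / t) ^ 2 + (t + 1) / 2 * (b + c + 2 * a / (t + 1)) ^ 2 +
      (t - 1) / 2 * (b - c) ^ 2 + (t - 1 / t - 2 / (t + 1)) * a ^ 2 := by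
    rw [h1]
    have : 0 ≤ (t - 1) / 2 := by linarith
    positivity
  have h3 : t * (d + a / t) ^ 2 + (t + 1) / 2 * (b + c + 2 * a / (t + 1)) ^ 2 +
      (t - 1) / 2 * (b - c) ^ 2 + (t - 1 / t - 2 / (t + 1)) * a ^ 2 =
      t * (a * a + b * b + c * c + d * d) +
        2 * (a * b + a * c + a * d + b * c) := by
    field_simp
    ring
  linarith

open Matrix in
lemma paw_mulVec {t : ℝ} (h : t ^ 3 + t ^ 2 - 3 * t - 1 = 0) :
    paw.adjMatrix ℝ *ᵥ ![t * (t + 1), -t, -t, -(t + 1)] =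
      (-t) • ![t * (t + 1), -t, -t, -(t + 1)] := by
  rw [paw_adjMatrix]
  ext i
  fin_cases i <;> simp [mulVec, dotProduct, Fin.sum_univ_four] <;> linarith

/-- The classes used to build `(m + 4)`-regular extensions of the paw. -/
def pawClass (n m : ℕ) (i : Fin 4) (x : ZMod (n + 1) × Fin (m + 4) × Fin (m + 3) × Fin (m + 2)) :
    ZMod (n + 1) × Fin (m + 4) × Fin (m + 3) × Fin (m + 2) :=
  match i with
  | 0 => (x.1, x.2.1, x.2.2.1, 0)
  | 1 => (x.1, x.2.1, 0, x.2.2.2)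
  | 2 => (x.1 + if x.2.2.1 = 0 then 1 else 0, x.2.1, 0, x.2.2.2)
  | 3 => (x.1, 0, x.2.2.1, x.2.2.2)

section pawClass

variable (n m : ℕ) (g : ZMod (n + 1) × Fin (m + 4) × Fin (m + 3) × Fin (m + 2) → ℝ)
  (l : ZMod (n + 1)) (a : Fin (m + 4)) (b : Fin (m + 3)) (d : Fin (m + 2))

lemma fiberSum_pawClass_zero :
    fiberSum (pawClass n m 0) g (l, a, b, d) = ∑ d', g (l, a, b, d') :=
  fiberSum_eq_sum_of_range g (fun _ _ h => by simpa using h) fun x => by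
    obtain ⟨l', a', b', d'⟩ := x
    simp [pawClass, eq_comm]

lemma fiberSum_pawClass_one :
    fiberSum (pawClass n m 1) g (l, a, b, d) = ∑ b', g (l, a, b', d) :=
  fiberSum_eq_sum_of_range g (fun _ _ h => by simpa using h) fun x => by
    obtain ⟨l', a', b', d'⟩ := x
    simp [pawClass, eq_comm]

lemma fiberSum_pawClass_two :
    fiberSum (pawClass n m 2) g (l, a, b, d) =
      ∑ b', g (l + (if b = 0 then 1 else 0) - (if b' = 0 then 1 else 0), a, b', d) :=
  fiberSum_eq_sum_of_range g
    (fun _ _ h => (Prod.ext_iff.1 (Prod.ext_iff.1 (Prod.ext_iff.1 h).2).2).1) fun x => by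
      obtain ⟨l', a', b', d'⟩ := x
      simp only [pawClass, Set.mem_range, Prod.mk.injEq, true_and, sub_eq_iff_eq_add]
      constructor
      · rintro ⟨h, rfl, rfl⟩
        exact ⟨b', h.symm, rfl, rfl, rfl⟩
      · rintro ⟨_, h, rfl, rfl, rfl⟩
        exact ⟨h.symm, rfl, rfl⟩

lemma fiberSum_pawClass_three :
    fiberSum (pawClass n m 3) g (l, a, b, d) = ∑ a', g (l, a', b, d) :=
  fiberSum_eq_sum_of_range g (fun _ _ h => by simpa using h) fun x => by
    obtain ⟨l', a', b', d'⟩ := x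
    simp [pawClass, eq_comm]

end pawClass

lemma pawExtension_isRegular (n m : ℕ) :
    (cliqueExtension paw (pawClass n m)).IsRegularOfDegree (m + 4) := by
  rintro ⟨⟨l, a, b, d⟩, i⟩
  have h := cliqueExtension_degree paw (pawClass n m) (l, a, b, d) i
  rw [paw_degree] at h
  rw [← Nat.cast_inj (R := ℝ), h]
  match i with
  | 0 => simp [fiberSum_pawClass_zero]; ring
  | 1 => simp [fiberSum_pawClass_one]; ring
  | 2 => simp [fiberSum_pawClass_two]; ring
  | 3 => simp [fiberSum_pawClass_three]

lemma pawExtension_connected (n m : ℕ) : (cliqueExtension paw (pawClass n m)).Connected := by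
  have step := fun i {x x'} (h : pawClass n m i x' = pawClass n m i x) =>
    cliqueExtension_reachable_of_eq paw_connected (pawClass n m) (j := 0) (k := 0) h
  have hlayer : ∀ l a b d, (cliqueExtension paw (pawClass n m)).Reachable
      ((l, 0, 0, 0), 0) ((l, a, b, d), 0) := fun l a b d =>
    (step 3 (x := (l, 0, 0, 0)) (x' := (l, a, 0, 0)) rfl).trans
      ((step 1 (x := (l, a, 0, 0)) (x' := (l, a, b, 0)) rfl).trans (step 0 (x' := (l, a, b, d)) rfl))
  have hnext : ∀ l, (cliqueExtension paw (pawClass n m)).Reachable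
      ((l, 0, 0, 0), 0) ((l + 1, 0, 0, 0), 0) := fun l =>
    (step 2 (x := (l, 0, 0, 0)) (x' := (l + 1, 0, 1, 0)) (by simp [pawClass])).trans
      (hlayer _ _ _ _).symm
  have hbase : ∀ r : ℕ, (cliqueExtension paw (pawClass n m)).Reachable
      ((0, 0, 0, 0), 0) (((r : ZMod (n + 1)), 0, 0, 0), 0) := by
    intro r
    induction r with
    | zero => simp
    | succ r ih => rw [Nat.cast_succ]; exact ih.trans (hnext _)
  rw [connected_iff_exists_forall_reachable]
  refine ⟨((0, 0, 0, 0), 0), ?_⟩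
  rintro ⟨⟨l, a, b, d⟩, i⟩
  have h := hbase l.val
  rw [ZMod.natCast_zmod_val] at h
  exact (h.trans (hlayer l a b d)).trans
    (cliqueExtension_reachable_of_eq paw_connected _ (i := i) rfl)

lemma lambdaMin_pawExtension (n m : ℕ) {t : ℝ} (ht : 1 < t)
    (h : t ^ 3 + t ^ 2 - 3 * t - 1 = 0) :
    lambdaMin (cliqueExtension paw (pawClass n m)) = -t - 1 := by
  let s : ∀ r : ℕ, Fin (r + 2) → ℝ := fun r => Pi.single 0 1 - Pi.single 1 1
  have hs : ∀ r, ∑ q, s r q = 0 := fun r => by simp [s]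
  have hs0 : ∀ r, s r 0 = 1 := fun r => by simp [s]
  let f : ZMod (n + 1) × Fin (m + 4) × Fin (m + 3) × Fin (m + 2) → ℝ :=
    fun x => s _ x.2.1 * s _ x.2.2.1 * s _ x.2.2.2
  refine lambdaMin_eq_of_form_le _ (cliqueExtension_form_le paw _ (paw_form_le ht h)) ?_
    (cliqueExtension_mulVec_tensor paw _ (paw_mulVec h) (f := f) ?_)
  · intro h0
    have := congrFun h0 ((0, 0, 0, 0), 0)
    simp [f, hs0] at this
    rcases this with this | this <;> linarith
  · rintro i ⟨l, a, b, d⟩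
    match i with
    | 0 => simp [fiberSum_pawClass_zero, f, ← Finset.mul_sum, hs]
    | 1 => simp [fiberSum_pawClass_one, f, ← Finset.mul_sum, ← Finset.sum_mul, hs]
    | 2 => simp [fiberSum_pawClass_two, f, ← Finset.mul_sum, ← Finset.sum_mul, hs]
    | 3 => simp [fiberSum_pawClass_three, f, ← Finset.sum_mul, hs]

lemma least_root_lt {α : ℝ} (h : IsLeast {x : ℝ | x ^ 3 + 2 * x ^ 2 - 2 * x - 2 = 0} α) :
    α < -1 - Real.sqrt 2 := by
  have hc : ContinuousOn (fun x : ℝ => x ^ 3 + 2 * x ^ 2 - 2 * x - 2)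
      (Set.Icc (-2.5) (-2.45)) := by fun_prop
  obtain ⟨x, hx, hx0⟩ := intermediate_value_Icc (by norm_num) hc
    (show (0 : ℝ) ∈ _ by constructor <;> norm_num)
  have h1 : α ≤ x := h.2 hx0
  have h2 : Real.sqrt 2 < 1.45 := by
    rw [Real.sqrt_lt' (by norm_num)]
    norm_num
  linarith [hx.2]

/-- There is a positive integer `N` such that for every `k ≥ N` there exist infinitely many
pairwise non-isomorphic connected `k`-regular finite simple graphs whose smallest adjacency
eigenvalue lies in `[α₁, -1-√2)`, where `α₁` is the smallest real root of `x³+2x²-2x-2`. -/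
theorem stmt_2 (α₁ : ℝ) (hα₁ : IsLeast {x : ℝ | x ^ 3 + 2 * x ^ 2 - 2 * x - 2 = 0} α₁) :
    ∃ N : ℕ, 0 < N ∧ ∀ k : ℕ, N ≤ k →
      ∃ f : ℕ → Σ n : ℕ, SimpleGraph (Fin n),
        (∀ i j : ℕ, i ≠ j → ¬ Nonempty ((f i).2 ≃g (f j).2)) ∧
        (∀ i : ℕ, ((f i).2.Connected ∧ (f i).2.IsRegularOfDegree k ∧
          α₁ ≤ lambdaMin (f i).2 ∧ lambdaMin (f i).2 < -1 - Real.sqrt 2)) := by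
  have hlt := least_root_lt hα₁
  have hroot : α₁ ^ 3 + 2 * α₁ ^ 2 - 2 * α₁ - 2 = 0 := hα₁.1
  have hsqrt : 1 < Real.sqrt 2 := by
    rw [Real.lt_sqrt (by norm_num)]
    norm_num
  refine ⟨4, by norm_num, fun k hk => ?_⟩
  obtain ⟨m, rfl⟩ := Nat.exists_eq_add_of_le' hk
  let e := fun n => (cliqueExtension paw (pawClass n m)).overFinIso rfl
  refine ⟨fun n => ⟨_, (cliqueExtension paw (pawClass n m)).overFin rfl⟩, ?_, fun n => ?_⟩
  · rintro i j hij ⟨φ⟩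
    have := Fintype.card_congr φ.toEquiv
    simp only [Fintype.card_fin, Fintype.card_prod, ZMod.card] at this
    exact hij (by simpa using this)
  · have hmin : lambdaMin ((cliqueExtension paw (pawClass n m)).overFin rfl) = α₁ := by
      rw [← (e n).lambdaMin_eq, lambdaMin_pawExtension n m (t := -α₁ - 1) (by linarith)
        (by linear_combination -hroot)]
      ring
    refine ⟨(e n).connected_iff.1 (pawExtension_connected n m), fun v => ?_, hmin.ge, hmin ▸ hlt⟩
    obtain ⟨p, rfl⟩ := (e n).surjective v
    exact ((e n).degree_eq p).trans (pawExtension_isRegular n m p)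
end

section
/- For each integer k ≥ 3, let η̂_k be the supremum of λmin(G) over all connected k-regular finite simple graphs G with λmin(G) < −2 (this set of graphs is nonempty for every k ≥ 3). Then the limit of η̂_k as k → ∞ equals −1−√2. -/
open SimpleGraph Filter

attribute [local instance] Classical.propDecidable

lemma le_lambdaMin_iff {V : Type} [Fintype V] [Nonempty V] (G : SimpleGraph V) (t : ℝ) :
    t ≤ lambdaMin G ↔ ∀ x : V → ℝ,
      t * ∑ v, x v ^ 2 ≤ ∑ u, ∑ v, if G.Adj u v then x u * x v else 0 := by
  have quad : ∀ x : V → ℝ, (∑ u, ∑ v, if G.Adj u v then x u * x v else 0)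
      = x ⬝ᵥ (G.adjMatrix ℝ).mulVec x := by
    intro x
    simp only [dotProduct, Matrix.mulVec, Finset.mul_sum, SimpleGraph.adjMatrix_apply]
    refine Finset.sum_congr rfl fun u _ => Finset.sum_congr rfl fun v _ => ?_
    split_ifs <;> ring
  have hA := adjMatrix_isHermitian G
  constructor
  · intro ht x
    have hev : ∀ i, t ≤ hA.eigenvalues i := fun i =>
      ht.trans (ciInf_le (Set.finite_range _).bddBelow i)
    have hpsd : ((G.adjMatrix ℝ) - t • (1 : Matrix V V ℝ)).PosSemidef := by
      have h1 := hA.spectral_theorem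
      have h2 : (G.adjMatrix ℝ) - t • (1 : Matrix V V ℝ) =
          (hA.eigenvectorUnitary : Matrix V V ℝ) *
            Matrix.diagonal (fun i => hA.eigenvalues i - t) *
            (hA.eigenvectorUnitary : Matrix V V ℝ).conjTranspose := by
        have h3 : Matrix.diagonal (fun i => hA.eigenvalues i - t) =
            Matrix.diagonal (fun i => hA.eigenvalues i) - t • (1 : Matrix V V ℝ) := by
          rw [Matrix.smul_one_eq_diagonal, Matrix.diagonal_sub]
        have h4 : (hA.eigenvectorUnitary : Matrix V V ℝ) *
            (hA.eigenvectorUnitary : Matrix V V ℝ).conjTranspose = 1 :=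
          Matrix.mem_unitaryGroup_iff.1 hA.eigenvectorUnitary.2
        rw [h3, Matrix.mul_sub, Matrix.sub_mul]
        simp only [Matrix.mul_smul, Matrix.smul_mul, Matrix.mul_one, h4]
        congr 1
        
      rw [h2]
      refine Matrix.PosSemidef.mul_mul_conjTranspose_same ?_ _
      exact Matrix.PosSemidef.diagonal fun i => sub_nonneg.2 (hev i)
    have := hpsd.dotProduct_mulVec_nonneg x
    rw [quad]
    simp only [star_trivial, Matrix.sub_mulVec, Matrix.smul_mulVec, Matrix.one_mulVec,
      dotProduct_sub, dotProduct_smul, smul_eq_mul] at this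
    have h5 : x ⬝ᵥ x = ∑ v, x v ^ 2 := by simp [dotProduct, sq]
    rw [h5] at this
    linarith
  · intro h
    refine le_ciInf fun i => ?_
    have h1 := h (hA.eigenvectorBasis i)
    rw [quad] at h1
    rw [hA.mulVec_eigenvectorBasis] at h1
    have h2 : ∑ v, (hA.eigenvectorBasis i) v ^ 2 = 1 := by
      have := hA.eigenvectorBasis.orthonormal.1 i
      rw [EuclideanSpace.norm_eq, Real.sqrt_eq_one] at this
      simpa using this
    rw [dotProduct_smul] at h1
    have h3 : (hA.eigenvectorBasis i : V → ℝ) ⬝ᵥ (hA.eigenvectorBasis i) = 1 := by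
      rw [← h2]; simp [dotProduct, sq]
    rw [h3, h2] at h1
    simpa using h1

/-- Vertices `(t, i, j)`: the layers `t = 0, 2` are split into cliques by `j`, the layer `t = 1` by
`i`, and for fixed `(i, j)` the three layers form a path with middle layer `1`. -/
def layeredGraph (k l : ℕ) : SimpleGraph (Fin 3 × Fin k × Fin l) where
  Adj p q := p ≠ q ∧
    ((p.1 = q.1 ∧ ((p.1 = 1 ∧ p.2.1 = q.2.1) ∨ (p.1 ≠ 1 ∧ p.2.2 = q.2.2))) ∨
      (p.2 = q.2 ∧ ((p.1 = 1 ∧ q.1 ≠ 1) ∨ (p.1 ≠ 1 ∧ q.1 = 1))))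
  symm := ⟨by
    rintro ⟨t, i, j⟩ ⟨t', i', j'⟩ h
    simp only [ne_eq, Prod.mk.injEq] at *
    grind⟩
  loopless := ⟨fun p h => h.1 rfl⟩

lemma layeredGraph_sum (k l : ℕ) (x : Fin 3 × Fin k × Fin l → ℝ) (p : Fin 3 × Fin k × Fin l) :
    (∑ q, if (layeredGraph k l).Adj p q then x q else 0) =
      (if p.1 = 1 then (∑ j, x (1, p.2.1, j)) + x (0, p.2) + x (2, p.2)
        else (∑ i, x (p.1, i, p.2.2)) + x (1, p.2)) - x p := by
  obtain ⟨t, i, j⟩ := p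
  have key : ∀ q : Fin 3 × Fin k × Fin l, (if (layeredGraph k l).Adj (t, i, j) q then x q else 0) =
      (if t = 1 then ((if q.1 = 1 ∧ q.2.1 = i then x q else 0) +
        (if q = (0, i, j) then x q else 0) + (if q = (2, i, j) then x q else 0))
      else ((if q.1 = t ∧ q.2.2 = j then x q else 0) + (if q = (1, i, j) then x q else 0)))
      - (if q = (t, i, j) then x q else 0) := by
    rintro ⟨t', i', j'⟩
    simp only [layeredGraph, ne_eq, Prod.mk.injEq]
    by_cases hi : i' = i <;> by_cases hj : j' = j <;> fin_cases t <;> fin_cases t' <;>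
      simp [hi, hj, eq_comm (a := i), eq_comm (a := j)]
  rw [Finset.sum_congr rfl fun q _ => key q, Finset.sum_sub_distrib, Finset.sum_ite_eq']
  have h1 : ∀ s : Fin 3, (∑ q : Fin 3 × Fin k × Fin l, if q.1 = s ∧ q.2.1 = i then x q else 0) =
      ∑ j, x (s, i, j) := by
    intro s
    simp only [Fintype.sum_prod_type, ite_and, Finset.sum_ite_irrel, Finset.sum_const_zero,
      Finset.sum_ite_eq', Finset.mem_univ, if_true]
    rw [Finset.sum_comm]
    simp
  have h2 : ∀ s : Fin 3, (∑ q : Fin 3 × Fin k × Fin l, if q.1 = s ∧ q.2.2 = j then x q else 0) =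
      ∑ i, x (s, i, j) := by
    intro s
    simp [Fintype.sum_prod_type, ite_and, Finset.sum_ite_irrel]
  by_cases ht : t = 1
  · simp only [ht, if_true, Finset.sum_add_distrib, h1, Finset.sum_ite_eq', Finset.mem_univ]
  · simp only [ht, if_false, Finset.sum_add_distrib, h2, Finset.sum_ite_eq', Finset.mem_univ,
      if_true]

lemma layeredGraph_regular (k : ℕ) (hk : 1 ≤ k) :
    (layeredGraph k (k - 1)).IsRegularOfDegree k := by
  intro p
  have h := layeredGraph_sum k (k - 1) (fun _ => 1) p
  have h2 : (∑ q, if (layeredGraph k (k - 1)).Adj p q then (1 : ℝ) else 0) =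
      ((layeredGraph k (k - 1)).degree p : ℝ) := by
    rw [Finset.sum_boole, ← SimpleGraph.card_neighborFinset_eq_degree]
    congr 2
    ext q
    simp
  rw [h2] at h
  have h3 : ((k - 1 : ℕ) : ℝ) = k - 1 := by push_cast [hk]; ring
  have : ((layeredGraph k (k - 1)).degree p : ℝ) = k := by
    rw [h]
    split_ifs <;> simp [h3]
  exact_mod_cast this

lemma layeredGraph_connected (k l : ℕ) (hk : 0 < k) (hl : 0 < l) :
    (layeredGraph k l).Connected := by
  have hmid : ∀ i j j', (layeredGraph k l).Reachable (1, i, j) (1, i, j') := by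
    intro i j j'
    by_cases h : j = j'
    · subst h; rfl
    · exact SimpleGraph.Adj.reachable (by simp [layeredGraph, h])
  have hcross : ∀ t i j, (layeredGraph k l).Reachable (t, i, j) (1, i, j) := by
    intro t i j
    by_cases h : t = 1
    · subst h; rfl
    · exact SimpleGraph.Adj.reachable (by simp [layeredGraph, h])
  have hend : ∀ i i' j, (layeredGraph k l).Reachable (0, i, j) (0, i', j) := by
    intro i i' j
    by_cases h : i = i'
    · subst h; rfl
    · exact SimpleGraph.Adj.reachable (by simp [layeredGraph, h])
  have : Nonempty (Fin 3 × Fin k × Fin l) := ⟨(0, ⟨0, hk⟩, ⟨0, hl⟩)⟩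
  refine SimpleGraph.Connected.mk ?_
  rintro ⟨t, i, j⟩ ⟨t', i', j'⟩
  exact (hcross t i j).trans ((hmid i j j').trans ((hcross 0 i j').symm.trans
    ((hend i i' j').trans ((hcross 0 i' j').trans (hcross t' i' j').symm))))

lemma layeredGraph_quad (k l : ℕ) (x : Fin 3 × Fin k × Fin l → ℝ) :
    (∑ p, ∑ q, if (layeredGraph k l).Adj p q then x p * x q else 0) =
      (∑ i, (∑ j, x (1, i, j)) ^ 2) + (∑ j, (∑ i, x (0, i, j)) ^ 2) +
        (∑ j, (∑ i, x (2, i, j)) ^ 2) +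
        (∑ i, ∑ j, 2 * x (1, i, j) * (x (0, i, j) + x (2, i, j))) - ∑ p, x p ^ 2 := by
  have h : ∀ p, (∑ q, if (layeredGraph k l).Adj p q then x p * x q else 0) =
      x p * (∑ q, if (layeredGraph k l).Adj p q then x q else 0) := by
    intro p
    rw [Finset.mul_sum]
    exact Finset.sum_congr rfl fun q _ => by split_ifs <;> simp
  simp only [h, layeredGraph_sum]
  simp only [Fintype.sum_prod_type, Fin.sum_univ_three]
  simp only [Fin.isValue, zero_ne_one, if_false, if_true, Fin.reduceEq, mul_sub, mul_add,
    Finset.sum_sub_distrib, Finset.sum_add_distrib, ← sq]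
  have e1 : ∑ i, ∑ j, x (1, i, j) * ∑ j', x (1, i, j') = ∑ i, (∑ j, x (1, i, j)) ^ 2 :=
    Finset.sum_congr rfl fun i _ => by rw [← Finset.sum_mul, sq]
  have e2 : ∀ t, ∑ i, ∑ j, x (t, i, j) * ∑ i', x (t, i', j) = ∑ j, (∑ i, x (t, i, j)) ^ 2 := by
    intro t
    rw [Finset.sum_comm]
    exact Finset.sum_congr rfl fun i _ => by rw [← Finset.sum_mul, sq]
  rw [e1, e2, e2]
  have e3 : ∀ t, ∑ i, ∑ j, 2 * x (1, i, j) * x (t, i, j) =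
      ∑ i, ∑ j, x (1, i, j) * x (t, i, j) + ∑ i, ∑ j, x (t, i, j) * x (1, i, j) := by
    intro t
    simp only [← Finset.sum_add_distrib]
    exact Finset.sum_congr rfl fun i _ => Finset.sum_congr rfl fun j _ => by ring
  rw [e3, e3]
  ring

lemma layeredGraph_lambdaMin (k l : ℕ) (hk : 2 ≤ k) (hl : 2 ≤ l) :
    lambdaMin (layeredGraph k l) = -1 - Real.sqrt 2 := by
  have : Nonempty (Fin 3 × Fin k × Fin l) := ⟨(0, ⟨0, by omega⟩, ⟨0, by omega⟩)⟩
  have hs : Real.sqrt 2 ^ 2 = 2 := Real.sq_sqrt (by norm_num)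
  apply le_antisymm
  · have h := (le_lambdaMin_iff (layeredGraph k l) _).1 le_rfl
    let a : Fin k → ℝ := fun i => if i.1 = 0 then 1 else if i.1 = 1 then -1 else 0
    let b : Fin l → ℝ := fun i => if i.1 = 0 then 1 else if i.1 = 1 then -1 else 0
    have hsum : ∀ m, 2 ≤ m →
        ∑ i : Fin m, (if i.1 = 0 then (1 : ℝ) else if i.1 = 1 then -1 else 0) = 0 := by
      intro m hm
      obtain ⟨m, rfl⟩ := Nat.exists_eq_add_of_le' hm
      simp [Fin.sum_univ_succ]
    have hsum2 : ∀ m, 2 ≤ m →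
        ∑ i : Fin m, (if i.1 = 0 then (1 : ℝ) else if i.1 = 1 then -1 else 0) ^ 2 = 2 := by
      intro m hm
      obtain ⟨m, rfl⟩ := Nat.exists_eq_add_of_le' hm
      simp [Fin.sum_univ_succ]
      norm_num
    have ha : ∑ i, a i = 0 := hsum k hk
    have hb : ∑ i, b i = 0 := hsum l hl
    have ha2 : ∑ i, a i ^ 2 = 2 := hsum2 k hk
    have hb2 : ∑ i, b i ^ 2 = 2 := hsum2 l hl
    let w : Fin 3 → ℝ := ![1, -Real.sqrt 2, 1]
    have h1 := h (fun p => w p.1 * (a p.2.1 * b p.2.2))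
    rw [layeredGraph_quad] at h1
    have e1 : ∀ c : ℝ, ∑ i, ∑ j, c * (a i ^ 2 * b j ^ 2) = c * 4 := by
      intro c
      simp only [← Finset.mul_sum, hb2, ← Finset.sum_mul, ha2]
      norm_num
    have e2 : ∑ p : Fin 3 × Fin k × Fin l, (w p.1 * (a p.2.1 * b p.2.2)) ^ 2 = 16 := by
      simp only [Fintype.sum_prod_type, Fin.sum_univ_three, mul_pow, e1]
      simp [w, hs]
      norm_num
    have e3 : ∑ i, ∑ j, 2 * (w 1 * (a i * b j)) * (w 0 * (a i * b j) + w 2 * (a i * b j)) =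
        2 * w 1 * (w 0 + w 2) * 4 := by
      rw [← e1]
      exact Finset.sum_congr rfl fun i _ => Finset.sum_congr rfl fun j _ => by ring
    rw [e2] at h1
    simp only [e3, ← Finset.mul_sum, hb, ← Finset.sum_mul, ha] at h1
    simp [w] at h1
    linarith
  · rw [le_lambdaMin_iff]
    intro x
    rw [layeredGraph_quad]
    have h0 : ∀ t, ∑ i, ∑ j, x (t, i, j) ^ 2 = ∑ i, ∑ j, x (t, i, j) ^ 2 := fun _ => rfl
    have h1 : 0 ≤ ∑ i, ∑ j, (2 * x (1, i, j) * (x (0, i, j) + x (2, i, j)) +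
        Real.sqrt 2 * (x (0, i, j) ^ 2 + x (1, i, j) ^ 2 + x (2, i, j) ^ 2)) := by
      refine Finset.sum_nonneg fun i _ => Finset.sum_nonneg fun j _ => ?_
      have hs0 : 0 < Real.sqrt 2 := by positivity
      have : Real.sqrt 2 * (2 * x (1, i, j) * (x (0, i, j) + x (2, i, j)) +
        Real.sqrt 2 * (x (0, i, j) ^ 2 + x (1, i, j) ^ 2 + x (2, i, j) ^ 2)) =
        (Real.sqrt 2 * x (1, i, j) + (x (0, i, j) + x (2, i, j))) ^ 2 +
          (x (0, i, j) - x (2, i, j)) ^ 2 := by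
        linear_combination (x (0, i, j) ^ 2 + x (2, i, j) ^ 2) * hs
      exact nonneg_of_mul_nonneg_right (this ▸ by positivity) hs0
    have h2 : ∑ p, x p ^ 2 =
        ∑ i, ∑ j, (x (0, i, j) ^ 2 + x (1, i, j) ^ 2 + x (2, i, j) ^ 2) := by
      simp only [Fintype.sum_prod_type, Fin.sum_univ_three, Finset.sum_add_distrib]
    simp only [Finset.sum_add_distrib, ← Finset.mul_sum] at h1 h2 ⊢
    have h3 : 0 ≤ ∑ i, (∑ j, x (1, i, j)) ^ 2 := by positivity
    have h4 : 0 ≤ ∑ j, (∑ i, x (0, i, j)) ^ 2 := by positivity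
    have h5 : 0 ≤ ∑ j, (∑ i, x (2, i, j)) ^ 2 := by positivity
    rw [h2]
    linarith

lemma lambdaMin_comap_equiv {V W : Type} [Fintype V] [Fintype W] [Nonempty V] [Nonempty W]
    (e : V ≃ W) (H : SimpleGraph W) : lambdaMin (H.comap e) = lambdaMin H := by
  have key : ∀ x : W → ℝ, (∑ v, (x (e v)) ^ 2 = ∑ v, x v ^ 2) ∧
      ((∑ u, ∑ v, if H.Adj (e u) (e v) then x (e u) * x (e v) else 0) =
        ∑ u, ∑ v, if H.Adj u v then x u * x v else 0) := by
    intro x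
    refine ⟨e.sum_comp fun v => x v ^ 2, ?_⟩
    rw [← e.sum_comp]
    refine Finset.sum_congr rfl fun u _ => ?_
    rw [← e.sum_comp]
  refine eq_of_forall_le_iff fun t => ?_
  simp only [le_lambdaMin_iff, SimpleGraph.comap_adj]
  constructor
  · intro h x
    have := h (fun v => x (e v))
    rwa [(key x).1, (key x).2] at this
  · intro h x
    have := h (fun v => x (e.symm v))
    rw [← (key _).1, ← (key _).2] at this
    simpa using this

lemma exists_regular_lambdaMin_eq (k : ℕ) (hk : 3 ≤ k) :
    ∃ (n : ℕ) (G : SimpleGraph (Fin n)), G.Connected ∧ G.IsRegularOfDegree k ∧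
      lambdaMin G = -1 - Real.sqrt 2 := by
  let e := Fintype.equivFin (Fin 3 × Fin k × Fin (k - 1))
  let H := layeredGraph k (k - 1)
  let φ : H.comap e.symm ≃g H := SimpleGraph.Iso.comap e.symm H
  refine ⟨_, H.comap e.symm, ?_, ?_, ?_⟩
  · exact φ.connected_iff.2 (layeredGraph_connected _ _ (by omega) (by omega))
  · intro v
    exact (φ.degree_eq v).symm.trans (layeredGraph_regular k (by omega) (φ v))
  · have : Nonempty (Fin 3 × Fin k × Fin (k - 1)) := ⟨(0, ⟨0, by omega⟩, ⟨0, by omega⟩)⟩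
    have : Nonempty (Fin (Fintype.card (Fin 3 × Fin k × Fin (k - 1)))) := e.symm.nonempty
    rw [← layeredGraph_lambdaMin k (k - 1) (by omega) (by omega)]
    exact lambdaMin_comap_equiv e.symm H

lemma exists_nclique_or_compl (s n : ℕ) : ∃ R : ℕ, ∀ {V : Type} (G : SimpleGraph V)
    (S : Finset V), R ≤ S.card →
      (∃ T ⊆ S, G.IsNClique n T) ∨ ∃ T ⊆ S, Gᶜ.IsNClique s T := by
  induction s generalizing n with
  | zero => exact ⟨0, fun G S _ => Or.inr ⟨∅, Finset.empty_subset _, by simp⟩⟩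
  | succ s ihs =>
    induction n with
    | zero => exact ⟨0, fun G S _ => Or.inl ⟨∅, Finset.empty_subset _, by simp⟩⟩
    | succ n ihn =>
      obtain ⟨R₁, h₁⟩ := ihs (n + 1)
      obtain ⟨R₂, h₂⟩ := ihn
      refine ⟨R₁ + R₂ + 1, fun {V} G S hS => ?_⟩
      obtain ⟨v, hv⟩ : S.Nonempty := Finset.card_pos.1 (by omega)
      have hcard := Finset.card_filter_add_card_filter_not (s := S.erase v) (fun u => G.Adj v u)
      rw [Finset.card_erase_of_mem hv] at hcard
      have hsub : ∀ (p : V → Prop) [DecidablePred p], (S.erase v).filter p ⊆ S := fun p _ =>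
        (Finset.filter_subset _ _).trans (Finset.erase_subset _ _)
      have hins : ∀ (p : V → Prop) [DecidablePred p] (T : Finset V), T ⊆ (S.erase v).filter p →
          insert v T ⊆ S := fun p _ T hT => Finset.insert_subset hv (hT.trans (hsub p))
      by_cases hN : R₂ ≤ ((S.erase v).filter fun u => G.Adj v u).card
      · rcases h₂ G _ hN with ⟨T, hT, hc⟩ | ⟨T, hT, hc⟩
        · exact Or.inl ⟨insert v T, hins _ T hT,
            hc.insert fun u hu => (Finset.mem_filter.1 (hT hu)).2⟩
        · exact Or.inr ⟨T, hT.trans (hsub _), hc⟩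
      · rcases h₁ G ((S.erase v).filter fun u => ¬ G.Adj v u) (by omega) with
          ⟨T, hT, hc⟩ | ⟨T, hT, hc⟩
        · exact Or.inl ⟨T, hT.trans (hsub _), hc⟩
        · refine Or.inr ⟨insert v T, hins _ T hT, hc.insert fun u hu => ?_⟩
          have hu' := Finset.mem_filter.1 (hT hu)
          exact (SimpleGraph.compl_adj _ _ _).2 ⟨(Finset.ne_of_mem_erase hu'.1).symm, hu'.2⟩

/-- The vectors `φ v` realise `A + τ I` as a Gram matrix, `A` being the adjacency matrix. -/
def IsGramRep {V E : Type} [NormedAddCommGroup E] [InnerProductSpace ℝ E]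
    (G : SimpleGraph V) (τ : ℝ) (φ : V → E) : Prop :=
  ∀ u v, inner ℝ (φ u) (φ v) = (if u = v then τ else 0) + (if G.Adj u v then 1 else 0)

open scoped MatrixOrder in
lemma exists_isGramRep {V : Type} [Fintype V] (G : SimpleGraph V) (τ : ℝ)
    (h : ∀ x : V → ℝ, -τ * ∑ v, x v ^ 2 ≤ ∑ u, ∑ v, if G.Adj u v then x u * x v else 0) :
    ∃ φ : V → EuclideanSpace ℝ V, IsGramRep G τ φ := by
  let A : Matrix V V ℝ := fun u v => (if u = v then τ else 0) + (if G.Adj u v then 1 else 0)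
  have hA : A.PosSemidef := by
    refine Matrix.PosSemidef.of_dotProduct_mulVec_nonneg ?_ fun x => ?_
    · refine Matrix.IsHermitian.ext fun u v => ?_
      simp [A, eq_comm (a := u), G.adj_comm u]
    · have h1 : star x ⬝ᵥ A.mulVec x =
          τ * ∑ v, x v ^ 2 + ∑ u, ∑ v, if G.Adj u v then x u * x v else 0 := by
        simp only [star_trivial, dotProduct, Matrix.mulVec, A, add_mul, Finset.sum_add_distrib,
          mul_add, Finset.mul_sum, ite_mul, zero_mul, one_mul, mul_ite, mul_zero,
          Finset.sum_ite_eq, Finset.mem_univ, if_true]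
        congr 1
        exact Finset.sum_congr rfl fun v _ => by ring
      rw [h1]
      linarith [h x]
  obtain ⟨B, hB⟩ := CStarAlgebra.nonneg_iff_eq_star_mul_self.1 hA.nonneg
  refine ⟨fun v => WithLp.toLp 2 fun i => B i v, fun u v => ?_⟩
  have h2 : A u v = ∑ i, B i u * B i v := by
    rw [hB]
    simp [Matrix.mul_apply, Matrix.star_eq_conjTranspose]
  change _ = A u v
  rw [h2]
  simp [PiLp.inner_apply, mul_comm]

lemma abs_average_sub_le {V : Type} (C X : Finset V) (f : V → ℝ) (c α : ℝ)
    (hC : 0 < C.card) (hα : 0 ≤ α) (hX : X.card ≤ 37) (h1 : ∀ v ∈ C, v ∉ X → |f v - c| ≤ α)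
    (h2 : ∀ v ∈ C, |f v - c| ≤ 5 / 2) :
    |(C.card : ℝ)⁻¹ * ∑ v ∈ C, f v - c| ≤ α + 100 / C.card := by
  have hC' : (0 : ℝ) < C.card := by exact_mod_cast hC
  have e : (C.card : ℝ)⁻¹ * ∑ v ∈ C, f v - c = (C.card : ℝ)⁻¹ * ∑ v ∈ C, (f v - c) := by
    rw [Finset.sum_sub_distrib, Finset.sum_const, nsmul_eq_mul]
    field_simp
  have hb : |∑ v ∈ C, (f v - c)| ≤ C.card * α + 5 / 2 * 37 := by
    calc |∑ v ∈ C, (f v - c)| ≤ ∑ v ∈ C, |f v - c| := Finset.abs_sum_le_sum_abs _ _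
      _ ≤ ∑ v ∈ C, (α + if v ∈ X then 5 / 2 else 0) := by
          refine Finset.sum_le_sum fun v hv => ?_
          split_ifs with hvX
          · linarith [h2 v hv]
          · linarith [h1 v hv hvX]
      _ = C.card * α + 5 / 2 * (C.filter (· ∈ X)).card := by
          rw [Finset.sum_add_distrib, Finset.sum_const, nsmul_eq_mul, ← Finset.sum_filter,
            Finset.sum_const, nsmul_eq_mul]
          ring
      _ ≤ C.card * α + 5 / 2 * 37 := by
          have : ((C.filter (· ∈ X)).card : ℝ) ≤ 37 := by
            exact_mod_cast (Finset.card_le_card fun v hv => (Finset.mem_filter.1 hv).2).trans hX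
          linarith
  rw [e, abs_mul, abs_of_pos (inv_pos.2 hC'), inv_mul_le_iff₀ hC']
  have : (C.card : ℝ) * (α + 100 / C.card) = C.card * α + 100 := by field_simp
  rw [this]
  linarith

lemma abs_sub_indicator_le {x ε : ℝ} (hε : ε < 1 / 2) (h : |x| ≤ ε ∨ |x - 1| ≤ ε) :
    |x - if 1 / 2 < x then 1 else 0| ≤ ε := by
  rcases h with h | h
  · have := abs_le.1 h
    rw [if_neg (by linarith)]
    simpa using h
  · have := abs_le.1 h
    rw [if_pos (by linarith)]
    exact h

section Gram

variable {V E : Type} [NormedAddCommGroup E] [InnerProductSpace ℝ E]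

/-- The average of the vectors `φ v` over `v ∈ C`. -/
noncomputable def average (φ : V → E) (C : Finset V) : E := (C.card : ℝ)⁻¹ • ∑ v ∈ C, φ v

lemma inner_average (φ : V → E) (C : Finset V) (z : E) :
    inner ℝ z (average φ C) = (C.card : ℝ)⁻¹ * ∑ v ∈ C, inner ℝ z (φ v) := by
  rw [average, inner_smul_right, inner_sum]

lemma le_inner_average (φ : V → E) {C : Finset V} (hC : C.Nonempty) (z : E) (b : ℝ)
    (h : ∀ v ∈ C, b ≤ inner ℝ z (φ v)) : b ≤ inner ℝ z (average φ C) := by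
  have hC' : (0 : ℝ) < C.card := by exact_mod_cast hC.card_pos
  rw [inner_average, le_inv_mul_iff₀ hC', ← nsmul_eq_mul]
  exact Finset.card_nsmul_le_sum _ _ _ h

lemma inner_average_le (φ : V → E) {C : Finset V} (hC : C.Nonempty) (z : E) (b : ℝ)
    (h : ∀ v ∈ C, inner ℝ z (φ v) ≤ b) : inner ℝ z (average φ C) ≤ b := by
  have hC' : (0 : ℝ) < C.card := by exact_mod_cast hC.card_pos
  rw [inner_average, inv_mul_le_iff₀ hC', ← nsmul_eq_mul]
  exact Finset.sum_le_card_nsmul _ _ _ h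

variable {G : SimpleGraph V} {τ : ℝ} {φ : V → E}

lemma IsGramRep.inner_self (hφ : IsGramRep G τ φ) (v : V) : inner ℝ (φ v) (φ v) = τ := by
  rw [hφ v v]
  simp

lemma IsGramRep.inner_average_of_mem (hφ : IsGramRep G τ φ) {C : Finset V} (hC : G.IsClique C)
    {v : V} (hv : v ∈ C) : inner ℝ (φ v) (average φ C) = 1 + (τ - 1) / C.card := by
  have hC' : (0 : ℝ) < C.card := by exact_mod_cast Finset.card_pos.2 ⟨v, hv⟩
  have h : ∀ u ∈ C, inner ℝ (φ v) (φ u) = 1 + if v = u then τ - 1 else 0 := by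
    intro u hu
    rw [hφ]
    by_cases huv : v = u
    · simp [huv]
    · simp [huv, hC hv hu huv]
  rw [inner_average, Finset.sum_congr rfl h, Finset.sum_add_distrib, Finset.sum_ite_eq, if_pos hv]
  simp
  field_simp

lemma IsGramRep.inner_average_self (hφ : IsGramRep G τ φ) {C : Finset V} (hC : G.IsClique C)
    (hne : C.Nonempty) : inner ℝ (average φ C) (average φ C) = 1 + (τ - 1) / C.card := by
  apply le_antisymm
  · refine inner_average_le φ hne _ _ fun v hv => ?_
    rw [real_inner_comm, hφ.inner_average_of_mem hC hv]
  · refine le_inner_average φ hne _ _ fun v hv => ?_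
    rw [real_inner_comm, hφ.inner_average_of_mem hC hv]

lemma IsGramRep.inner_average_disjoint (hφ : IsGramRep G τ φ) {C C₁ C₀ : Finset V}
    (hC : G.IsClique C) (h₁ : C₁ ⊆ C) (h₀ : C₀ ⊆ C) (hd : Disjoint C₁ C₀) (hne₁ : C₁.Nonempty)
    (hne₀ : C₀.Nonempty) : inner ℝ (average φ C₁) (average φ C₀) = 1 := by
  have h : ∀ u ∈ C₁, ∀ v ∈ C₀, inner ℝ (φ u) (φ v) = 1 := by
    intro u hu v hv
    have huv : u ≠ v := fun h => Finset.disjoint_left.1 hd hu (h ▸ hv)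
    simp [hφ u v, huv, hC (h₁ hu) (h₀ hv) huv]
  have h' : ∀ u ∈ C₁, inner ℝ (φ u) (average φ C₀) = 1 := fun u hu =>
    le_antisymm (inner_average_le φ hne₀ _ _ fun v hv => (h u hu v hv).le)
      (le_inner_average φ hne₀ _ _ fun v hv => (h u hu v hv).ge)
  rw [real_inner_comm]
  refine le_antisymm (inner_average_le φ hne₁ _ _ fun v hv => ?_)
      (le_inner_average φ hne₁ _ _ fun v hv => ?_)
  · rw [real_inner_comm, h' v hv]
  · rw [real_inner_comm, h' v hv]

/-- A short vector cannot separate two large parts of a clique. -/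
lemma IsGramRep.card_le_of_separated (hφ : IsGramRep G τ φ) (hτ₂ : 2 ≤ τ) (hτ₃ : τ ≤ 5 / 2)
    {C C₁ C₀ : Finset V}
    (hC : G.IsClique C) (h₁ : C₁ ⊆ C) (h₀ : C₀ ⊆ C) (z : E) (hz : inner ℝ z z ≤ 3) (b : ℝ)
    (hb₁ : ∀ v ∈ C₁, b + 1 / 2 ≤ inner ℝ z (φ v)) (hb₀ : ∀ v ∈ C₀, inner ℝ z (φ v) ≤ b) :
    C₁.card ≤ 36 ∨ C₀.card ≤ 36 := by
  by_contra! hcon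
  obtain ⟨hc₁, hc₀⟩ := hcon
  have hne₁ : C₁.Nonempty := Finset.card_pos.1 (by omega)
  have hne₀ : C₀.Nonempty := Finset.card_pos.1 (by omega)
  have hd : Disjoint C₁ C₀ := Finset.disjoint_left.2 fun v hv hv' => by
    linarith [hb₁ v hv, hb₀ v hv']
  have e₁ := hφ.inner_average_self (hC.subset (Finset.coe_subset.2 h₁)) hne₁
  have e₀ := hφ.inner_average_self (hC.subset (Finset.coe_subset.2 h₀)) hne₀
  have e₁₀ := hφ.inner_average_disjoint hC h₁ h₀ hd hne₁ hne₀
  have hz₁ := le_inner_average φ hne₁ z _ hb₁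
  have hz₀ := inner_average_le φ hne₀ z _ hb₀
  have hcs := real_inner_mul_inner_self_le z (average φ C₁ - average φ C₀)
  have hnorm : inner ℝ (average φ C₁ - average φ C₀) (average φ C₁ - average φ C₀) =
      (τ - 1) / C₁.card + (τ - 1) / C₀.card := by
    rw [inner_sub_left, inner_sub_right, inner_sub_right, e₁, e₀, e₁₀, real_inner_comm, e₁₀]
    ring
  have hle : ∀ m : ℕ, 36 < m → (τ - 1) / m ≤ (3 / 2) / 37 := by
    intro m hm
    have : (37 : ℝ) ≤ m := by exact_mod_cast hm
    exact div_le_div₀ (by norm_num) (by linarith) (by norm_num) this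
  have hge : ∀ m : ℕ, 0 ≤ (τ - 1) / m := fun m => div_nonneg (by linarith) (Nat.cast_nonneg _)
  rw [hnorm, inner_sub_right] at hcs
  have h3 : (1 / 2 : ℝ) ≤ inner ℝ z (average φ C₁) - inner ℝ z (average φ C₀) := by linarith
  have h4 : inner ℝ z z * ((τ - 1) / C₁.card + (τ - 1) / C₀.card) ≤
      3 * ((3 / 2) / 37 + (3 / 2) / 37) :=
    mul_le_mul hz (add_le_add (hle _ hc₁) (hle _ hc₀)) (add_nonneg (hge _) (hge _)) (by norm_num)
  nlinarith

/-- The indicator of `v` being adjacent to almost all of the clique `C`. -/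
noncomputable def near (φ : V → E) (v : V) (C : Finset V) : ℝ :=
  if 1 / 2 < inner ℝ (φ v) (average φ C) then 1 else 0

lemma near_eq_zero_or_one (φ : V → E) (v : V) (C : Finset V) :
    near φ v C = 0 ∨ near φ v C = 1 := by
  rw [near]; split_ifs <;> simp

lemma IsGramRep.abs_inner_average_sub_near (hφ : IsGramRep G τ φ) (hτ₂ : 2 ≤ τ) (hτ₃ : τ ≤ 5 / 2)
    {n : ℕ} (hn : 1000 ≤ n) {C : Finset V} (hC : G.IsNClique n C) (v : V) :
    |inner ℝ (φ v) (average φ C) - near φ v C| ≤ 100 / n := by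
  have hn' : (1000 : ℝ) ≤ n := by exact_mod_cast hn
  have hε : (100 : ℝ) / n < 1 / 2 := by
    rw [div_lt_iff₀ (by linarith)]; linarith
  refine abs_sub_indicator_le hε ?_
  have hcard := hC.card_eq
  have hval : ∀ u, u ≠ v → inner ℝ (φ v) (φ u) = 0 ∨ inner ℝ (φ v) (φ u) = 1 := by
    intro u hu
    rw [hφ v u, if_neg (Ne.symm hu)]
    split_ifs <;> simp
  have hself := hφ.inner_self v
  have hdev : ∀ c : ℝ, 0 ≤ c → c ≤ 1 → ∀ u ∈ C, |inner ℝ (φ v) (φ u) - c| ≤ 5 / 2 := by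
    intro c hc0 hc1 u _
    by_cases huv : u = v
    · subst huv
      rw [hself, abs_le]
      constructor <;> linarith
    · rw [abs_le]
      rcases hval u huv with h | h <;> rw [h] <;> constructor <;> linarith
  have hlow : ∀ u, ¬ 1 / 2 ≤ inner ℝ (φ v) (φ u) → inner ℝ (φ v) (φ u) = 0 := by
    intro u hu
    by_cases huv : u = v
    · subst huv
      exact absurd (by rw [hself]; linarith) hu
    · exact (hval u huv).resolve_right fun h => hu (by rw [h]; norm_num)
  have hsep := hφ.card_le_of_separated hτ₂ hτ₃ hC.isClique
    (Finset.filter_subset (fun u => 1 / 2 ≤ inner ℝ (φ v) (φ u)) C)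
    (Finset.filter_subset (fun u => ¬ 1 / 2 ≤ inner ℝ (φ v) (φ u)) C) (φ v)
    (by rw [hself]; linarith) 0 (fun u hu => by simpa using (Finset.mem_filter.1 hu).2)
    (fun u hu => (hlow u (Finset.mem_filter.1 hu).2).le)
  rcases hsep with hs | hs
  · left
    have h := abs_average_sub_le C _ (fun u => inner ℝ (φ v) (φ u)) 0 0 (by omega) le_rfl
      (hs.trans (by norm_num))
      (fun u hu hu' => by
        rw [hlow u fun h => hu' (Finset.mem_filter.2 ⟨hu, h⟩)]; simp)
      (hdev 0 le_rfl zero_le_one)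
    rw [← inner_average, hcard] at h
    simpa using h
  · right
    have h := abs_average_sub_le C (insert v (C.filter fun u => ¬ 1 / 2 ≤ inner ℝ (φ v) (φ u)))
      (fun u => inner ℝ (φ v) (φ u)) 1 0 (by omega) le_rfl
      ((Finset.card_insert_le _ _).trans (by omega))
      (fun u hu hu' => by
        have huv : u ≠ v := fun h => hu' (h ▸ Finset.mem_insert_self _ _)
        rcases hval u huv with h | h
        · exact absurd (Finset.mem_insert_of_mem (Finset.mem_filter.2
            ⟨hu, by rw [h]; norm_num⟩)) hu'
        · rw [h]; simp)
      (hdev 1 zero_le_one le_rfl)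
    rw [← inner_average, hcard] at h
    simpa using h

lemma IsGramRep.inner_average_average (hφ : IsGramRep G τ φ) (hτ₂ : 2 ≤ τ) (hτ₃ : τ ≤ 5 / 2)
    {n : ℕ} (hn : 1000 ≤ n) {C D : Finset V} (hC : G.IsNClique n C) (hD : G.IsNClique n D) :
    |inner ℝ (average φ C) (average φ D)| ≤ 200 / n ∨
      |inner ℝ (average φ C) (average φ D) - 1| ≤ 200 / n := by
  have hn' : (1000 : ℝ) ≤ n := by exact_mod_cast hn
  have hε : (100 : ℝ) / n ≤ 1 / 10 := by
    rw [div_le_iff₀ (by linarith)]; linarith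
  have hε0 : (0 : ℝ) ≤ 100 / n := by positivity
  have hcard := hD.card_eq
  have hCne : C.Nonempty := Finset.card_pos.1 (by rw [hC.card_eq]; omega)
  have hclose : ∀ u, |inner ℝ (average φ C) (φ u) - near φ u C| ≤ 100 / n := fun u => by
    rw [real_inner_comm]
    exact hφ.abs_inner_average_sub_near hτ₂ hτ₃ hn hC u
  have hself : inner ℝ (average φ C) (average φ C) ≤ 3 := by
    rw [hφ.inner_average_self hC.isClique hCne, hC.card_eq]
    have : (τ - 1) / n ≤ 2 := by
      rw [div_le_iff₀ (by linarith)]; linarith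
    linarith
  have hdev : ∀ c : ℝ, 0 ≤ c → c ≤ 1 →
      ∀ u ∈ D, |inner ℝ (average φ C) (φ u) - c| ≤ 5 / 2 := by
    intro c hc0 hc1 u _
    have h := abs_le.1 (hclose u)
    rw [abs_le]
    rcases near_eq_zero_or_one φ u C with h0 | h0 <;> rw [h0] at h <;> constructor <;> linarith
  have hsep := hφ.card_le_of_separated hτ₂ hτ₃ hD.isClique
    (Finset.filter_subset (fun u => near φ u C = 1) D)
    (Finset.filter_subset (fun u => near φ u C = 0) D) (average φ C) hself (1 / 4)
    (fun u hu => by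
      have h := abs_le.1 (hclose u)
      rw [(Finset.mem_filter.1 hu).2] at h
      linarith)
    (fun u hu => by
      have h := abs_le.1 (hclose u)
      rw [(Finset.mem_filter.1 hu).2] at h
      linarith)
  have e : (200 : ℝ) / n = 100 / n + 100 / n := by ring
  rw [e]
  rcases hsep with hs | hs
  · left
    have h := abs_average_sub_le D _ (fun u => inner ℝ (average φ C) (φ u)) 0 (100 / n) (by omega)
      hε0 (hs.trans (by norm_num))
      (fun u hu hu' => by
        have h0 := (near_eq_zero_or_one φ u C).resolve_right fun h =>
          hu' (Finset.mem_filter.2 ⟨hu, h⟩)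
        rw [← h0]
        exact hclose u)
      (hdev 0 le_rfl zero_le_one)
    rw [← inner_average, hcard] at h
    simpa using h
  · right
    have h := abs_average_sub_le D _ (fun u => inner ℝ (average φ C) (φ u)) 1 (100 / n) (by omega)
      hε0 (hs.trans (by norm_num))
      (fun u hu hu' => by
        have h0 := (near_eq_zero_or_one φ u C).resolve_left fun h =>
          hu' (Finset.mem_filter.2 ⟨hu, h⟩)
        rw [← h0]
        exact hclose u)
      (hdev 1 zero_le_one le_rfl)
    rw [← inner_average, hcard] at h
    exact h

/-- A maximal family of `n`-cliques whose averages are pairwise nearly orthogonal. -/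
lemma IsGramRep.exists_clique_family [Fintype V] (hφ : IsGramRep G τ φ) (hτ₂ : 2 ≤ τ)
    (hτ₃ : τ ≤ 5 / 2) {n : ℕ} (hn : 1000000 ≤ n) :
    ∃ F : Finset (Finset V), (∀ C ∈ F, G.IsNClique n C) ∧
      (∀ C ∈ F, ∀ D ∈ F, C ≠ D → |inner ℝ (average φ C) (average φ D)| ≤ 200 / n) ∧
      (∀ D, G.IsNClique n D → ∀ v ∈ D, ∃ C ∈ F, near φ v C = 1) := by
  have hn' : (1000000 : ℝ) ≤ n := by exact_mod_cast hn
  have hn0 : (0 : ℝ) < n := by linarith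
  have hsmall : (200 : ℝ) / n ≤ 1 / 5000 := by
    rw [div_le_iff₀ hn0]; linarith
  obtain ⟨F, hF, hmax⟩ := Finset.exists_max_image
    (Finset.univ.filter fun F : Finset (Finset V) => (∀ C ∈ F, G.IsNClique n C) ∧
      (∀ C ∈ F, ∀ D ∈ F, C ≠ D → |inner ℝ (average φ C) (average φ D)| ≤ 200 / n))
    Finset.card ⟨∅, by simp⟩
  obtain ⟨hFc, hFd⟩ := (Finset.mem_filter.1 hF).2
  refine ⟨F, hFc, hFd, fun D hD v hv => ?_⟩
  have hselfs : ∀ C, G.IsNClique n C → inner ℝ (average φ C) (average φ C) = 1 + (τ - 1) / n := by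
    intro C hC
    have := hφ.inner_average_self hC.isClique (Finset.card_pos.1 (by rw [hC.card_eq]; omega))
    rwa [hC.card_eq] at this
  have hτn : (τ - 1) / n ≤ 200 / n := by
    gcongr; linarith
  have hτn0 : 0 ≤ (τ - 1) / n := div_nonneg (by linarith) hn0.le
  have hvD := hφ.inner_average_of_mem hD.isClique hv
  rw [hD.card_eq] at hvD
  obtain ⟨C, hC, hCD⟩ :
      ∃ C ∈ F, |inner ℝ (average φ C) (average φ D) - 1| ≤ 200 / n := by
    by_contra! hcon
    have horth : ∀ C ∈ F, |inner ℝ (average φ C) (average φ D)| ≤ 200 / n := fun C hC =>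
      (hφ.inner_average_average hτ₂ hτ₃ (by omega) (hFc C hC) hD).resolve_right
        (not_le.2 (hcon C hC))
    have hDF : D ∉ F := fun h => by
      have := abs_le.1 (horth D h)
      rw [hselfs D hD] at this
      linarith
    have hle := hmax (insert D F) (Finset.mem_filter.2 ⟨Finset.mem_univ _, ?_, ?_⟩)
    · rw [Finset.card_insert_of_notMem hDF] at hle
      omega
    · intro C hC
      rcases Finset.mem_insert.1 hC with rfl | hC
      · exact hD
      · exact hFc C hC
    · intro C hC C' hC' hne
      rcases Finset.mem_insert.1 hC with rfl | hCF <;>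
        rcases Finset.mem_insert.1 hC' with rfl | hCF'
      · exact absurd rfl hne
      · rw [real_inner_comm]
        exact horth C' hCF'
      · exact horth C hCF
      · exact hFd C hCF C' hCF' hne
  refine ⟨C, hC, ?_⟩
  rw [near, if_pos]
  have hcs := real_inner_mul_inner_self_le (φ v) (average φ C - average φ D)
  have hnorm : inner ℝ (average φ C - average φ D) (average φ C - average φ D) ≤ 4 / 5000 := by
    rw [inner_sub_left, inner_sub_right, inner_sub_right, hselfs C (hFc C hC), hselfs D hD,
      real_inner_comm (average φ C) (average φ D)]
    have := abs_le.1 hCD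
    linarith
  have hbound : inner ℝ (φ v) (φ v) *
      inner ℝ (average φ C - average φ D) (average φ C - average φ D) ≤ 5 / 2 * (4 / 5000) := by
    rw [hφ.inner_self]
    exact mul_le_mul hτ₃ hnorm real_inner_self_nonneg (by norm_num)
  rw [inner_sub_right, hvD] at hcs
  by_contra hcon
  nlinarith

end Gram

/-- A quantitative Bessel inequality for an almost orthonormal family. -/
lemma sum_sq_le_of_almost_orthonormal {E ι : Type} [DecidableEq ι] [NormedAddCommGroup E]
    [InnerProductSpace ℝ E]
    (T : Finset ι) (ψ : ι → E) (x : E) (c : ι → ℝ) (ε : ℝ) (hT : T.card ≤ 6)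
    (hc : ∀ i ∈ T, |c i| ≤ 6) (hx : ∀ i ∈ T, |inner ℝ x (ψ i) - c i| ≤ 6 * ε)
    (hψ : ∀ i ∈ T, ∀ j ∈ T, |inner ℝ (ψ i) (ψ j) - if i = j then 1 else 0| ≤ ε) (hε : 0 ≤ ε) :
    ∑ i ∈ T, c i ^ 2 ≤ inner ℝ x x + 2000 * ε := by
  have hT' : (T.card : ℝ) ≤ 6 := by exact_mod_cast hT
  have hpos : 0 ≤ inner ℝ (x - ∑ i ∈ T, c i • ψ i) (x - ∑ i ∈ T, c i • ψ i) :=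
    real_inner_self_nonneg
  have hexp : inner ℝ (x - ∑ i ∈ T, c i • ψ i) (x - ∑ i ∈ T, c i • ψ i) =
      inner ℝ x x - 2 * ∑ i ∈ T, c i * inner ℝ x (ψ i) +
        ∑ i ∈ T, ∑ j ∈ T, c i * c j * inner ℝ (ψ i) (ψ j) := by
    rw [inner_sub_left, inner_sub_right, inner_sub_right,
      real_inner_comm x (∑ i ∈ T, c i • ψ i)]
    have e1 : inner ℝ x (∑ i ∈ T, c i • ψ i) = ∑ i ∈ T, c i * inner ℝ x (ψ i) := by
      simp [inner_sum, inner_smul_right]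
    have e2 : inner ℝ (∑ i ∈ T, c i • ψ i) (∑ i ∈ T, c i • ψ i) =
        ∑ i ∈ T, ∑ j ∈ T, c i * c j * inner ℝ (ψ i) (ψ j) := by
      simp only [inner_sum, sum_inner, inner_smul_left, inner_smul_right, Finset.mul_sum]
      rw [Finset.sum_comm]
      refine Finset.sum_congr rfl fun i _ => Finset.sum_congr rfl fun j _ => ?_
      simp
      ring
    rw [e1, e2]
    ring
  have h1 : ∑ i ∈ T, (c i ^ 2 - 36 * ε) ≤ ∑ i ∈ T, c i * inner ℝ x (ψ i) := by
    refine Finset.sum_le_sum fun i hi => ?_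
    have h : |c i * (inner ℝ x (ψ i) - c i)| ≤ 6 * (6 * ε) := by
      rw [abs_mul]
      exact mul_le_mul (hc i hi) (hx i hi) (abs_nonneg _) (by norm_num)
    have := (abs_le.1 h).1
    linarith
  have h2 : ∑ i ∈ T, ∑ j ∈ T, c i * c j * inner ℝ (ψ i) (ψ j) ≤
      ∑ i ∈ T, ∑ j ∈ T, ((if i = j then c i * c j else 0) + 36 * ε) := by
    refine Finset.sum_le_sum fun i hi => Finset.sum_le_sum fun j hj => ?_
    have h : |c i * c j * (inner ℝ (ψ i) (ψ j) - if i = j then 1 else 0)| ≤ 6 * 6 * ε := by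
      rw [abs_mul, abs_mul]
      exact mul_le_mul (mul_le_mul (hc i hi) (hc j hj) (abs_nonneg _) (by norm_num))
        (hψ i hi j hj) (abs_nonneg _) (by norm_num)
    have := (abs_le.1 h).2
    split_ifs at this ⊢ <;> linarith
  have h3 : ∑ i ∈ T, ∑ j ∈ T, ((if i = j then c i * c j else 0) + 36 * ε) =
      ∑ i ∈ T, c i ^ 2 + T.card * (T.card * (36 * ε)) := by
    simp only [Finset.sum_add_distrib, Finset.sum_const, nsmul_eq_mul]
    congr 1
    refine Finset.sum_congr rfl fun i hi => ?_
    rw [Finset.sum_ite_eq, if_pos hi, sq]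
  rw [Finset.sum_sub_distrib, Finset.sum_const, nsmul_eq_mul] at h1
  have h4 : (T.card : ℝ) * (36 * ε) ≤ 6 * (36 * ε) := by gcongr
  have h5 : (T.card : ℝ) * (T.card * (36 * ε)) ≤ 6 * (6 * (36 * ε)) := by gcongr
  linarith

/-- The number of cliques of `F` that both `u` and `v` are near to. -/
noncomputable def commonNear {V E : Type} [NormedAddCommGroup E] [InnerProductSpace ℝ E]
    (φ : V → E) (F : Finset (Finset V)) (u v : V) : ℕ :=
  (F.filter fun C => near φ u C = 1 ∧ near φ v C = 1).card

section Gram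

variable {V E : Type} [NormedAddCommGroup E] [InnerProductSpace ℝ E]
  {G : SimpleGraph V} {τ : ℝ} {φ : V → E} {F : Finset (Finset V)}

lemma sum_near_mul_near (φ : V → E) (F : Finset (Finset V)) (u v : V) :
    ∑ C ∈ F, near φ u C * near φ v C = commonNear φ F u v := by
  rw [commonNear, Finset.natCast_card_filter]
  refine Finset.sum_congr rfl fun C _ => ?_
  rcases near_eq_zero_or_one φ u C with h | h <;> rcases near_eq_zero_or_one φ v C with h' | h' <;>
    simp [h, h']

lemma commonNear_comm (φ : V → E) (F : Finset (Finset V)) (u v : V) :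
    commonNear φ F u v = commonNear φ F v u := by
  simp only [commonNear, and_comm]

lemma IsGramRep.commonNear_self_le (hφ : IsGramRep G τ φ) (hτ₂ : 2 ≤ τ) (hτ₃ : τ ≤ 5 / 2) {n : ℕ}
    (hn : 1000000 ≤ n) (hF : ∀ C ∈ F, G.IsNClique n C)
    (horth : ∀ C ∈ F, ∀ D ∈ F, |inner ℝ (average φ C) (average φ D) - if C = D then 1 else 0| ≤
      200 / n) (v : V) : commonNear φ F v v ≤ 2 := by
  by_contra! hcon
  obtain ⟨T, hT, hT3⟩ := Finset.exists_subset_card_eq hcon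
  have hn' : (1000000 : ℝ) ≤ n := by exact_mod_cast hn
  have hsmall : (200 : ℝ) / n ≤ 1 / 5000 := by
    rw [div_le_iff₀ (by linarith)]; linarith
  have hTF : ∀ C ∈ T, C ∈ F ∧ near φ v C = 1 := fun C hC => by
    have := Finset.mem_filter.1 (hT hC)
    exact ⟨this.1, this.2.1⟩
  have h := sum_sq_le_of_almost_orthonormal T (average φ) (φ v) (fun _ => 1) (200 / n) (by omega)
    (fun _ _ => by norm_num) (fun C hC => by
      have := hφ.abs_inner_average_sub_near hτ₂ hτ₃ (by omega) (hF C (hTF C hC).1) v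
      rw [(hTF C hC).2] at this
      refine this.trans ?_
      rw [← mul_div_assoc]
      gcongr
      norm_num)
    (fun C hC D hD => horth C (hTF C hC).1 D (hTF D hD).1) (by positivity)
  rw [hφ.inner_self, Finset.sum_const, hT3] at h
  norm_num at h
  linarith

lemma IsGramRep.sum_sq_near_le (hφ : IsGramRep G τ φ) (hτ₂ : 2 ≤ τ) (hτ₃ : τ ≤ 5 / 2) {n : ℕ}
    (hn : 1000000 ≤ n) (hF : ∀ C ∈ F, G.IsNClique n C)
    (horth : ∀ C ∈ F, ∀ D ∈ F, |inner ℝ (average φ C) (average φ D) - if C = D then 1 else 0| ≤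
      200 / n) (u v w : V) {α β γ : ℝ} (hα : |α| ≤ 2) (hβ : |β| ≤ 2) (hγ : |γ| ≤ 2) :
    ∑ C ∈ F, (α * near φ u C + β * near φ v C + γ * near φ w C) ^ 2 ≤
      inner ℝ (α • φ u + β • φ v + γ • φ w) (α • φ u + β • φ v + γ • φ w) + 2000 * (200 / n) := by
  let S : V → Finset (Finset V) := fun u => F.filter fun C => near φ u C = 1
  have hS : ∀ u, (S u).card ≤ 2 := fun u => by
    have := hφ.commonNear_self_le hτ₂ hτ₃ hn hF horth u
    simpa only [commonNear, and_self] using this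
  have hsub : S u ∪ S v ∪ S w ⊆ F := Finset.union_subset
    (Finset.union_subset (Finset.filter_subset _ _) (Finset.filter_subset _ _))
    (Finset.filter_subset _ _)
  have hnear : ∀ C, ∀ x, |near φ x C| ≤ 1 := fun C x => by
    rcases near_eq_zero_or_one φ x C with h | h <;> simp [h]
  have hprod : ∀ {a b c d : ℝ}, |a| ≤ c → |b| ≤ d → 0 ≤ c → |a * b| ≤ c * d := by
    intro a b c d hac hbd hc
    rw [abs_mul]
    exact mul_le_mul hac hbd (abs_nonneg _) hc
  have h := sum_sq_le_of_almost_orthonormal (S u ∪ S v ∪ S w) (average φ)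
    (α • φ u + β • φ v + γ • φ w) (fun C => α * near φ u C + β * near φ v C + γ * near φ w C)
    (200 / n)
    (by
      have h1 := Finset.card_union_le (S u ∪ S v) (S w)
      have h2 := Finset.card_union_le (S u) (S v)
      have := hS u
      have := hS v
      have := hS w
      omega)
    (fun C _ => by
      have h1 := abs_le.1 (hprod hα (hnear C u) zero_le_two)
      have h2 := abs_le.1 (hprod hβ (hnear C v) zero_le_two)
      have h3 := abs_le.1 (hprod hγ (hnear C w) zero_le_two)
      rw [abs_le]
      constructor <;> linarith)
    (fun C hC => by
      have hd := fun x => hφ.abs_inner_average_sub_near hτ₂ hτ₃ (by omega) (hF C (hsub hC)) x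
      have h1 := abs_le.1 (hprod hα (hd u) zero_le_two)
      have h2 := abs_le.1 (hprod hβ (hd v) zero_le_two)
      have h3 := abs_le.1 (hprod hγ (hd w) zero_le_two)
      have e : (200 : ℝ) / n = 2 * (100 / n) := by ring
      have e0 : (0 : ℝ) ≤ 100 / n := by positivity
      rw [inner_add_left, inner_add_left, real_inner_smul_left, real_inner_smul_left,
        real_inner_smul_left, abs_le, e]
      constructor <;> linarith)
    (fun C hC D hD => horth C (hsub hC) D (hsub hD)) (by positivity)
  refine le_trans (le_of_eq ?_) h
  refine (Finset.sum_subset hsub fun C hC hC' => ?_).symm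
  have h0 : ∀ x, C ∉ S x → near φ x C = 0 := fun x hx =>
    (near_eq_zero_or_one φ x C).resolve_right fun h => hx (Finset.mem_filter.2 ⟨hC, h⟩)
  simp only [Finset.mem_union, not_or] at hC'
  simp [h0 u hC'.1.1, h0 v hC'.1.2, h0 w hC'.2]

/-- The matrix `A + 2 I - N Nᵀ`, `N` being the incidence matrix of vertices and cliques near
them. -/
noncomputable def residualEntry (G : SimpleGraph V) (φ : V → E) (F : Finset (Finset V))
    (u v : V) : ℤ :=
  (if u = v then 2 else 0) + (if G.Adj u v then 1 else 0) - commonNear φ F u v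

lemma residualEntry_comm (G : SimpleGraph V) (φ : V → E) (F : Finset (Finset V)) (u v : V) :
    residualEntry G φ F u v = residualEntry G φ F v u := by
  rw [residualEntry, residualEntry, commonNear_comm]
  simp only [eq_comm, G.adj_comm]

lemma IsGramRep.inner_eq_residualEntry (hφ : IsGramRep G τ φ) (F : Finset (Finset V)) (u v : V) :
    inner ℝ (φ u) (φ v) =
      residualEntry G φ F u v + commonNear φ F u v + if u = v then τ - 2 else 0 := by
  rw [hφ, residualEntry]
  push_cast
  split_ifs <;> ring

lemma IsGramRep.residualEntry_nonneg (hφ : IsGramRep G τ φ) (hτ₂ : 2 ≤ τ) (hτ₃ : τ ≤ 5 / 2) {n : ℕ}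
    (hn : 1000000 ≤ n) (hF : ∀ C ∈ F, G.IsNClique n C)
    (horth : ∀ C ∈ F, ∀ D ∈ F, |inner ℝ (average φ C) (average φ D) - if C = D then 1 else 0| ≤
      200 / n) (u v w : V) (huv : u ≠ v) (hvw : v ≠ w) (huw : u ≠ w)
    {α β γ : ℝ} (hα : |α| ≤ 2) (hβ : |β| ≤ 2) (hγ : |γ| ≤ 2) :
    0 ≤ α ^ 2 * (residualEntry G φ F u u + (τ - 2)) + β ^ 2 * (residualEntry G φ F v v + (τ - 2)) +
      γ ^ 2 * (residualEntry G φ F w w + (τ - 2)) + 2 * (α * β) * residualEntry G φ F u v +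
      2 * (β * γ) * residualEntry G φ F v w + 2 * (α * γ) * residualEntry G φ F u w + 2000 * (200 / n) := by
  have h := hφ.sum_sq_near_le hτ₂ hτ₃ hn hF horth u v w hα hβ hγ
  have e1 : ∑ C ∈ F, (α * near φ u C + β * near φ v C + γ * near φ w C) ^ 2 =
      α ^ 2 * commonNear φ F u u + β ^ 2 * commonNear φ F v v + γ ^ 2 * commonNear φ F w w +
        2 * (α * β) * commonNear φ F u v + 2 * (β * γ) * commonNear φ F v w +
        2 * (α * γ) * commonNear φ F u w := by
    simp only [← sum_near_mul_near, Finset.mul_sum, ← Finset.sum_add_distrib]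
    exact Finset.sum_congr rfl fun C _ => by ring
  simp only [inner_add_left, inner_add_right, real_inner_smul_left, real_inner_smul_right] at h
  rw [real_inner_comm (φ u) (φ v), real_inner_comm (φ u) (φ w), real_inner_comm (φ v) (φ w),
    e1] at h
  simp only [hφ.inner_eq_residualEntry F, huv, hvw, huw, if_true, if_false] at h
  linarith

lemma IsGramRep.residualEntry_nonneg_pair (hφ : IsGramRep G τ φ) (hτ₂ : 2 ≤ τ)
    (hτ₃ : τ ≤ 5 / 2) {n : ℕ}
    (hn : 1000000 ≤ n) (hF : ∀ C ∈ F, G.IsNClique n C)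
    (horth : ∀ C ∈ F, ∀ D ∈ F, |inner ℝ (average φ C) (average φ D) - if C = D then 1 else 0| ≤
      200 / n) (u v : V) (huv : u ≠ v) {α β : ℝ} (hα : |α| ≤ 2) (hβ : |β| ≤ 2) :
    0 ≤ α ^ 2 * (residualEntry G φ F u u + (τ - 2)) + β ^ 2 * (residualEntry G φ F v v + (τ - 2)) +
      2 * (α * β) * residualEntry G φ F u v + 2000 * (200 / n) := by
  have h := hφ.sum_sq_near_le hτ₂ hτ₃ hn hF horth u v v hα hβ (γ := 0) (by simp)
  have e1 : ∑ C ∈ F, (α * near φ u C + β * near φ v C + 0 * near φ v C) ^ 2 =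
      α ^ 2 * commonNear φ F u u + β ^ 2 * commonNear φ F v v +
        2 * (α * β) * commonNear φ F u v := by
    simp only [← sum_near_mul_near, Finset.mul_sum, ← Finset.sum_add_distrib]
    exact Finset.sum_congr rfl fun C _ => by ring
  simp only [inner_add_left, inner_add_right, real_inner_smul_left, real_inner_smul_right] at h
  rw [real_inner_comm (φ u) (φ v), e1] at h
  simp only [hφ.inner_eq_residualEntry F, huv, if_true, if_false] at h
  linarith

end Gram

lemma sum_mul_nonneg_of_block {V : Type} [Fintype V] (M : V → V → ℤ)
    (hsymm : ∀ u v, M u v = M v u) (hdiag : ∀ u v, M u v ≠ 0 → M u u = 1)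
    (htrans : ∀ u v w, M u v ≠ 0 → M v w ≠ 0 → M u w = M u v * M v w) (x : V → ℝ) :
    0 ≤ ∑ u, ∑ v, (M u v : ℝ) * (x u * x v) := by
  let d : V → ℝ := fun v => (Finset.univ.filter fun u => M v u ≠ 0).card
  have hd : ∀ u v, M u v ≠ 0 → d u = d v := by
    intro u v h
    have : ∀ w, M u w ≠ 0 ↔ M v w ≠ 0 := fun w =>
      ⟨fun hw => by
        rw [htrans v u w (by rwa [hsymm]) hw]
        exact mul_ne_zero (by rwa [hsymm]) hw,
      fun hw => by
        rw [htrans u v w h hw]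
        exact mul_ne_zero h hw⟩
    simp only [d, this]
  have key : ∀ u w, (M u w : ℝ) = ∑ v, (M v u : ℝ) * M v w / d v := by
    intro u w
    by_cases h : M u w = 0
    · rw [h, Int.cast_zero]
      refine (Finset.sum_eq_zero fun v _ => ?_).symm
      by_cases h1 : M v u = 0
      · simp [h1]
      by_cases h2 : M v w = 0
      · simp [h2]
      rw [hsymm] at h1
      rw [htrans u v w h1 h2] at h
      exact absurd h (mul_ne_zero h1 h2)
    · have h1 : ∀ v, (M v u : ℝ) * M v w / d v = if M u v ≠ 0 then (M u w : ℝ) / d u else 0 := by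
        intro v
        split_ifs with hv
        · have hvw : M v w ≠ 0 := by
            rw [htrans v u w (by rwa [hsymm]) h]
            exact mul_ne_zero (by rwa [hsymm]) h
          rw [← hd u v hv, htrans u v w hv hvw, hsymm v u, Int.cast_mul]
        · rw [not_not] at hv
          rw [hsymm v u, hv]
          simp
      have hpos : d u ≠ 0 := by
        have hu : u ∈ Finset.univ.filter fun v => M u v ≠ 0 := by simp [hdiag u w h]
        exact Nat.cast_ne_zero.2 (Finset.card_ne_zero_of_mem hu)
      rw [Finset.sum_congr rfl fun v _ => h1 v, ← Finset.sum_filter, Finset.sum_const,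
        nsmul_eq_mul]
      change (M u w : ℝ) = d u * (M u w / d u)
      field_simp
  have h2 : ∑ u, ∑ w, (M u w : ℝ) * (x u * x w) = ∑ v, (∑ u, M v u * x u) ^ 2 / d v := by
    have h3 : ∀ v, (∑ u, M v u * x u) ^ 2 / d v =
        ∑ u, ∑ w, (M v u : ℝ) * M v w / d v * (x u * x w) := by
      intro v
      rw [sq, Finset.sum_mul_sum, Finset.sum_div]
      refine Finset.sum_congr rfl fun u _ => ?_
      rw [Finset.sum_div]
      exact Finset.sum_congr rfl fun w _ => by ring
    rw [Finset.sum_congr rfl fun v _ => h3 v]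
    refine Eq.trans (Finset.sum_congr rfl fun u _ => ?_) Finset.sum_comm
    refine Eq.trans (Finset.sum_congr rfl fun w _ => ?_) Finset.sum_comm
    rw [← Finset.sum_mul, ← key u w]
  rw [h2]
  exact Finset.sum_nonneg fun v _ => div_nonneg (sq_nonneg _) (Nat.cast_nonneg _)

/-- If `A + τ I` is positive semidefinite with `τ < 1 + √2` and all vertices lie in large cliques,
then `A + 2 I` is positive semidefinite. -/
lemma IsGramRep.quadratic_form_ge {V E : Type} [Fintype V] [NormedAddCommGroup E]
    [InnerProductSpace ℝ E] {G : SimpleGraph V} {τ : ℝ} {φ : V → E} (hφ : IsGramRep G τ φ)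
    (hτ₂ : 2 ≤ τ) {n : ℕ} (hn : 1000000 ≤ n) (hτn : 100000 / n < 1 + Real.sqrt 2 - τ)
    (hcl : ∀ v, ∃ C, G.IsNClique n C ∧ v ∈ C) (x : V → ℝ) :
    -2 * ∑ v, x v ^ 2 ≤ ∑ u, ∑ v, if G.Adj u v then x u * x v else 0 := by
  have hs2 : Real.sqrt 2 ^ 2 = 2 := Real.sq_sqrt (by norm_num)
  have hs0 : 0 ≤ Real.sqrt 2 := Real.sqrt_nonneg 2
  have hslt : Real.sqrt 2 < 1.415 := by
    rw [Real.sqrt_lt' (by norm_num)]; norm_num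
  have hn' : (1000000 : ℝ) ≤ n := by exact_mod_cast hn
  have hη : 2000 * (200 / (n : ℝ)) = 4 * (100000 / n) := by ring
  have hη0 : (0 : ℝ) ≤ 100000 / n := by positivity
  have hη1 : (100000 : ℝ) / n ≤ 1 / 10 := by
    rw [div_le_iff₀ (by linarith)]; linarith
  have hτ₃ : τ ≤ 5 / 2 := by linarith
  have hτ₄ : τ ≤ 2.415 := by linarith
  obtain ⟨F, hF, horth', hcov⟩ := hφ.exists_clique_family hτ₂ hτ₃ hn
  have horth : ∀ C ∈ F, ∀ D ∈ F,
      |inner ℝ (average φ C) (average φ D) - if C = D then 1 else 0| ≤ 200 / n := by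
    intro C hC D hD
    by_cases hCD : C = D
    · subst hCD
      rw [hφ.inner_average_self (hF C hC).isClique
        (Finset.card_pos.1 (by rw [(hF C hC).card_eq]; omega)), (hF C hC).card_eq, if_pos rfl,
        add_sub_cancel_left, abs_of_nonneg (div_nonneg (by linarith) (by linarith))]
      gcongr
      linarith
    · simpa [hCD] using horth' C hC D hD hCD
  let M := residualEntry G φ F
  have hdiag : ∀ u, M u u = 0 ∨ M u u = 1 := by
    intro u
    have h1 := hφ.commonNear_self_le hτ₂ hτ₃ hn hF horth u
    have h2 : 0 < commonNear φ F u u := by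
      obtain ⟨D, hD, hu⟩ := hcl u
      obtain ⟨C, hC, hCu⟩ := hcov D hD u hu
      exact Finset.card_pos.2 ⟨C, Finset.mem_filter.2 ⟨hC, hCu, hCu⟩⟩
    simp only [M, residualEntry, SimpleGraph.irrefl, if_true, if_false]
    omega
  have hsymm : ∀ u v, M u v = M v u := residualEntry_comm G φ F
  have hzero : ∀ u v, M u v ≠ 0 → M u u = 1 := by
    intro u v huv
    refine (hdiag u).resolve_left fun h0 => ?_
    have hne : u ≠ v := fun h => huv (h ▸ h0)
    have hv : (M v v : ℝ) ≤ 1 := by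
      rcases hdiag v with h | h <;> simp [h]
    have h0' : (M u u : ℝ) = 0 := by exact_mod_cast h0
    rcases lt_or_gt_of_ne huv with h | h
    · have h' : (M u v : ℝ) ≤ -1 := by exact_mod_cast (by omega : M u v ≤ -1)
      have := hφ.residualEntry_nonneg_pair hτ₂ hτ₃ hn hF horth u v hne (α := 2) (β := 1)
        (by norm_num) (by norm_num)
      change 0 ≤ 2 ^ 2 * ((M u u : ℝ) + (τ - 2)) + 1 ^ 2 * ((M v v : ℝ) + (τ - 2)) +
        2 * (2 * 1) * (M u v : ℝ) + 2000 * (200 / n) at this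
      rw [hη, h0'] at this
      linarith
    · have h' : (1 : ℝ) ≤ M u v := by exact_mod_cast (by omega : 1 ≤ M u v)
      have := hφ.residualEntry_nonneg_pair hτ₂ hτ₃ hn hF horth u v hne (α := 2) (β := -1)
        (by norm_num) (by norm_num)
      change 0 ≤ 2 ^ 2 * ((M u u : ℝ) + (τ - 2)) + (-1) ^ 2 * ((M v v : ℝ) + (τ - 2)) +
        2 * (2 * -1) * (M u v : ℝ) + 2000 * (200 / n) at this
      rw [hη, h0'] at this
      linarith
  have hzero' : ∀ u v, M u v ≠ 0 → M v v = 1 := fun u v h => hzero v u (by rwa [hsymm])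
  have hunit : ∀ u v, M u v ≠ 0 → M u v = 1 ∨ M u v = -1 := by
    intro u v huv
    have hu := hzero u v huv
    have hv := hzero' u v huv
    by_cases hne : u = v
    · subst hne
      exact Or.inl hu
    have hu' : (M u u : ℝ) = 1 := by exact_mod_cast hu
    have hv' : (M v v : ℝ) = 1 := by exact_mod_cast hv
    by_contra! hcon
    rcases lt_or_gt_of_ne huv with h | h
    · have h' : (M u v : ℝ) ≤ -2 := by exact_mod_cast (by omega : M u v ≤ -2)
      have := hφ.residualEntry_nonneg_pair hτ₂ hτ₃ hn hF horth u v hne (α := 1) (β := 1)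
        (by norm_num) (by norm_num)
      change 0 ≤ 1 ^ 2 * ((M u u : ℝ) + (τ - 2)) + 1 ^ 2 * ((M v v : ℝ) + (τ - 2)) +
        2 * (1 * 1) * (M u v : ℝ) + 2000 * (200 / n) at this
      rw [hη, hu', hv'] at this
      linarith
    · have h' : (2 : ℝ) ≤ M u v := by exact_mod_cast (by omega : 2 ≤ M u v)
      have := hφ.residualEntry_nonneg_pair hτ₂ hτ₃ hn hF horth u v hne (α := 1) (β := -1)
        (by norm_num) (by norm_num)
      change 0 ≤ 1 ^ 2 * ((M u u : ℝ) + (τ - 2)) + (-1) ^ 2 * ((M v v : ℝ) + (τ - 2)) +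
        2 * (1 * -1) * (M u v : ℝ) + 2000 * (200 / n) at this
      rw [hη, hu', hv'] at this
      linarith
  have htrans : ∀ u v w, M u v ≠ 0 → M v w ≠ 0 → M u w = M u v * M v w := by
    intro u v w huv hvw
    have hu := hzero u v huv
    have hv := hzero v w hvw
    have hw := hzero' v w hvw
    by_cases h1 : u = v
    · subst h1
      rw [hu, one_mul]
    by_cases h2 : v = w
    · subst h2
      rw [hv, mul_one]
    by_cases h3 : u = w
    · subst h3
      rw [hsymm v u, hu]
      rcases hunit u v huv with h | h <;> rw [h] <;> norm_num
    have hu' : (M u u : ℝ) = 1 := by exact_mod_cast hu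
    have hv' : (M v v : ℝ) = 1 := by exact_mod_cast hv
    have hw' : (M w w : ℝ) = 1 := by exact_mod_cast hw
    have ha : (M u v : ℝ) ^ 2 = 1 := by
      rcases hunit u v huv with h | h <;> rw [h] <;> norm_num
    have hb : (M v w : ℝ) ^ 2 = 1 := by
      rcases hunit v w hvw with h | h <;> rw [h] <;> norm_num
    by_contra hcon
    have hc : (M u v : ℝ) * M v w * M u w ≤ 0 := by
      have : M u v * M v w * M u w ≤ 0 := by
        by_cases huw : M u w = 0
        · rw [huw, mul_zero]
        rcases hunit u v huv with h | h <;> rcases hunit v w hvw with h' | h' <;>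
          rcases hunit u w huw with h'' | h'' <;> simp [h, h', h''] at hcon ⊢
      exact_mod_cast this
    have hle : ∀ a : ℝ, a ^ 2 = 1 → |-a| ≤ 2 := fun a h => by
      rw [abs_neg]
      exact abs_le_of_sq_le_sq (by linarith) (by norm_num)
    have := hφ.residualEntry_nonneg hτ₂ hτ₃ hn hF horth u v w h1 h2 h3 (α := -M u v)
      (β := Real.sqrt 2) (γ := -M v w) (hle _ ha)
      (by rw [abs_of_nonneg hs0]; linarith) (hle _ hb)
    change 0 ≤ (-(M u v : ℝ)) ^ 2 * ((M u u : ℝ) + (τ - 2)) +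
      Real.sqrt 2 ^ 2 * ((M v v : ℝ) + (τ - 2)) + (-(M v w : ℝ)) ^ 2 * ((M w w : ℝ) + (τ - 2)) +
      2 * (-(M u v : ℝ) * Real.sqrt 2) * (M u v : ℝ) +
      2 * (Real.sqrt 2 * -(M v w : ℝ)) * (M v w : ℝ) +
      2 * (-(M u v : ℝ) * -(M v w : ℝ)) * (M u w : ℝ) + 2000 * (200 / n) at this
    rw [hη, hu', hv', hw', hs2, neg_sq, neg_sq, ha, hb] at this
    have e1 : 2 * (-(M u v : ℝ) * Real.sqrt 2) * (M u v : ℝ) = -2 * Real.sqrt 2 := by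
      linear_combination (-2 * Real.sqrt 2) * ha
    have e2 : 2 * (Real.sqrt 2 * -(M v w : ℝ)) * (M v w : ℝ) = -2 * Real.sqrt 2 := by
      linear_combination (-2 * Real.sqrt 2) * hb
    rw [e1, e2] at this
    linarith
  have hM := sum_mul_nonneg_of_block M hsymm hzero htrans x
  have hP : 0 ≤ ∑ u, ∑ v, (commonNear φ F u v : ℝ) * (x u * x v) := by
    have : ∑ u, ∑ v, (commonNear φ F u v : ℝ) * (x u * x v) =
        ∑ C ∈ F, (∑ u, near φ u C * x u) ^ 2 := by
      simp only [← sum_near_mul_near, Finset.sum_mul]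
      rw [Finset.sum_congr rfl fun u _ => Finset.sum_comm, Finset.sum_comm]
      refine Finset.sum_congr rfl fun C _ => ?_
      rw [sq, Finset.sum_mul_sum]
      exact Finset.sum_congr rfl fun u _ => Finset.sum_congr rfl fun v _ => by ring
    rw [this]
    exact Finset.sum_nonneg fun C _ => sq_nonneg _
  have hsum : ∑ u, ∑ v, (M u v : ℝ) * (x u * x v) +
      ∑ u, ∑ v, (commonNear φ F u v : ℝ) * (x u * x v) =
      2 * ∑ v, x v ^ 2 + ∑ u, ∑ v, if G.Adj u v then x u * x v else 0 := by
    rw [← Finset.sum_add_distrib, Finset.mul_sum, ← Finset.sum_add_distrib]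
    refine Finset.sum_congr rfl fun u _ => ?_
    have : 2 * x u ^ 2 = ∑ v, if u = v then 2 * x u ^ 2 else 0 := by simp
    rw [this, ← Finset.sum_add_distrib, ← Finset.sum_add_distrib]
    refine Finset.sum_congr rfl fun v _ => ?_
    simp only [M, residualEntry]
    push_cast
    by_cases huv : u = v
    · subst huv
      simp
      ring
    · simp only [huv, if_false]
      split_ifs <;> ring
  linarith

lemma IsGramRep.not_isNClique_compl {V E : Type} [NormedAddCommGroup E]
    [InnerProductSpace ℝ E] {G : SimpleGraph V} {τ : ℝ} {φ : V → E} (hφ : IsGramRep G τ φ)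
    (hτ₃ : τ ≤ 5 / 2) (v : V) (T : Finset V) (hT : ∀ u ∈ T, G.Adj v u) : ¬ Gᶜ.IsNClique 9 T := by
  intro hc
  have hpos : 0 ≤ inner ℝ ((3 : ℝ) • φ v - ∑ u ∈ T, φ u) ((3 : ℝ) • φ v - ∑ u ∈ T, φ u) :=
    real_inner_self_nonneg
  have e1 : inner ℝ (φ v) (∑ u ∈ T, φ u) = 9 := by
    have : ∀ u ∈ T, inner ℝ (φ v) (φ u) = 1 := fun u hu => by
      rw [hφ, if_neg (hT u hu).ne, if_pos (hT u hu)]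
      norm_num
    rw [inner_sum, Finset.sum_congr rfl this, Finset.sum_const, hc.card_eq]
    norm_num
  have e2 : inner ℝ (∑ u ∈ T, φ u) (∑ u ∈ T, φ u) = 9 * τ := by
    have : ∀ u ∈ T, inner ℝ (∑ w ∈ T, φ w) (φ u) = τ := fun u hu => by
      rw [sum_inner, Finset.sum_eq_single_of_mem u hu, hφ.inner_self]
      intro w hw hne
      have := (SimpleGraph.compl_adj _ _ _).1 (hc.isClique hw hu hne)
      rw [hφ, if_neg hne, if_neg this.2, add_zero]
    rw [inner_sum, Finset.sum_congr rfl this, Finset.sum_const, hc.card_eq, nsmul_eq_mul]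
    norm_num
  simp only [inner_sub_left, inner_sub_right, real_inner_smul_left, real_inner_smul_right,
    real_inner_comm (φ v) (∑ u ∈ T, φ u), e1, e2, hφ.inner_self] at hpos
  linarith

lemma eventually_lambdaMin_le {ε : ℝ} (hε : 0 < ε) :
    ∃ K : ℕ, ∀ k ≥ K, ∀ (n : ℕ) (G : SimpleGraph (Fin n)), G.Connected →
      G.IsRegularOfDegree k → lambdaMin G < -2 → lambdaMin G ≤ -1 - Real.sqrt 2 + ε := by
  obtain ⟨m, hm⟩ := exists_nat_gt (100000 / ε)
  let N := m + 1000000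
  obtain ⟨K, hK⟩ := exists_nclique_or_compl 9 N
  refine ⟨K, fun k hk n G hconn hreg hlt => ?_⟩
  have := hconn.nonempty
  by_contra! hcon
  refine hlt.not_ge ((le_lambdaMin_iff G (-2)).2 fun x => ?_)
  have hτ := (le_lambdaMin_iff G _).1 hcon.le
  have hslt : Real.sqrt 2 < 1.415 := by
    rw [Real.sqrt_lt' (by norm_num)]; norm_num
  obtain ⟨φ, hφ⟩ := exists_isGramRep G (1 + Real.sqrt 2 - ε) fun x => by
    have := hτ x
    rwa [show -(1 + Real.sqrt 2 - ε) = -1 - Real.sqrt 2 + ε by ring]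
  refine hφ.quadratic_form_ge (n := N + 1) (by linarith) (by omega) ?_ (fun v => ?_) x
  · have hN : (100000 : ℝ) / ε < (N + 1 : ℕ) := by
      refine hm.trans ?_
      exact_mod_cast (by omega : m < N + 1)
    rw [div_lt_iff₀ hε] at hN
    rw [div_lt_iff₀ (by positivity)]
    linarith
  · have hcard : K ≤ (G.neighborFinset v).card := by
      rw [SimpleGraph.card_neighborFinset_eq_degree, hreg v]
      exact hk
    rcases hK G _ hcard with ⟨T, hT, hc⟩ | ⟨T, hT, hc⟩
    · exact ⟨insert v T, hc.insert fun u hu => (SimpleGraph.mem_neighborFinset _ _ _).1 (hT hu),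
        Finset.mem_insert_self _ _⟩
    · exact absurd hc (hφ.not_isNClique_compl (by linarith) v T fun u hu =>
        (SimpleGraph.mem_neighborFinset _ _ _).1 (hT hu))

/-- `η̂_k`, the supremum of `λmin` over connected `k`-regular graphs with `λmin < -2`
(a nonempty collection for every `k ≥ 3`), tends to `-1-√2` as `k → ∞`. -/
theorem stmt_3 :
    (∀ k : ℕ, 3 ≤ k →
      {x : ℝ | ∃ (n : ℕ) (G : SimpleGraph (Fin n)), G.Connected ∧ G.IsRegularOfDegree k ∧
        lambdaMin G < -2 ∧ lambdaMin G = x}.Nonempty) ∧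
    Tendsto (fun k : ℕ =>
        sSup {x : ℝ | ∃ (n : ℕ) (G : SimpleGraph (Fin n)), G.Connected ∧
          G.IsRegularOfDegree k ∧ lambdaMin G < -2 ∧ lambdaMin G = x})
      atTop (nhds (-1 - Real.sqrt 2)) := by
  have hsgt : 1 < Real.sqrt 2 := by
    rw [Real.lt_sqrt (by norm_num)]; norm_num
  have hmem : ∀ k : ℕ, 3 ≤ k → -1 - Real.sqrt 2 ∈
      {x : ℝ | ∃ (n : ℕ) (G : SimpleGraph (Fin n)), G.Connected ∧ G.IsRegularOfDegree k ∧
        lambdaMin G < -2 ∧ lambdaMin G = x} := by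
    intro k hk
    obtain ⟨n, G, hc, hr, hl⟩ := exists_regular_lambdaMin_eq k hk
    exact ⟨n, G, hc, hr, by rw [hl]; linarith, hl⟩
  refine ⟨fun k hk => ⟨_, hmem k hk⟩, ?_⟩
  rw [Metric.tendsto_atTop]
  intro ε hε
  obtain ⟨K, hK⟩ := eventually_lambdaMin_le (half_pos hε)
  refine ⟨max K 3, fun k hk => ?_⟩
  have hk3 : 3 ≤ k := (le_max_right _ _).trans hk
  have hub : ∀ x ∈ {x : ℝ | ∃ (n : ℕ) (G : SimpleGraph (Fin n)), G.Connected ∧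
      G.IsRegularOfDegree k ∧ lambdaMin G < -2 ∧ lambdaMin G = x},
      x ≤ -1 - Real.sqrt 2 + ε / 2 := by
    rintro x ⟨n, G, hc, hr, hl, rfl⟩
    exact hK k ((le_max_left _ _).trans hk) n G hc hr hl
  have h1 := csSup_le ⟨_, hmem k hk3⟩ hub
  have h2 := le_csSup ⟨_, hub⟩ (hmem k hk3)
  rw [Real.dist_eq, abs_lt]
  constructor <;> linarith
end
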